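/- Let n₀, n₁, m₀, m₁ be natural numbers with n₁ ≤ n₀, m₁ − m₀ ≥ 2, and n₀ − n₁ ≤ m₁ − m₀ − 1. For natural numbers N, M let σ_{N,M} denote the self-map of the one-point compactification of ℂ^N × ℝ^M obtained by extending the map (v, x) ↦ (i·v, −x) by sending the point at infinity ∞ to ∞; let ρ_N denote the self-map of the one-point compactification of ℂ^N extending v ↦ i·v by ∞ ↦ ∞, and τ_M the self-map of the one-point compactification of ℝ^M extending x ↦ −x by ∞ ↦ ∞. Suppose there exists a continuous map f from the one-point compactification of ℂ^{n₀} × ℝ^{m₀} to the one-point compactification of ℂ^{n₁} × ℝ^{m₁} such that f(∞) = ∞, f(0) = 0, and f ∘ σ_{n₀,m₀} = σ_{n₁,m₁} ∘ f. Then there exists a continuous map g from the one-point compactification of ℂ^{n₀−n₁} to the one-point compactification of ℝ^{m₁−m₀} such that g(∞) = ∞, g(0) = 0, and g ∘ ρ_{n₀−n₁} = τ_{m₁−m₀} ∘ g. -/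

import Mathlib

open OnePoint

/-- The self-map `σ_{N,M}` of the one-point compactification of `ℂ^N × ℝ^M`,
extending `(v, x) ↦ (i • v, -x)` by `∞ ↦ ∞`. -/
noncomputable def sigmaMap (N M : ℕ) :
    OnePoint (EuclideanSpace ℂ (Fin N) × EuclideanSpace ℝ (Fin M)) →
      OnePoint (EuclideanSpace ℂ (Fin N) × EuclideanSpace ℝ (Fin M)) :=
  OnePoint.map fun p => (Complex.I • p.1, -p.2)

/-- The self-map `ρ_N` of the one-point compactification of `ℂ^N`,
extending `v ↦ i • v` by `∞ ↦ ∞`. -/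
noncomputable def rhoMap (N : ℕ) :
    OnePoint (EuclideanSpace ℂ (Fin N)) → OnePoint (EuclideanSpace ℂ (Fin N)) :=
  OnePoint.map fun v => Complex.I • v

/-- The self-map `τ_M` of the one-point compactification of `ℝ^M`,
extending `x ↦ -x` by `∞ ↦ ∞`. -/
noncomputable def tauMap (M : ℕ) :
    OnePoint (EuclideanSpace ℝ (Fin M)) → OnePoint (EuclideanSpace ℝ (Fin M)) :=
  OnePoint.map fun x => -x

namespace Desuspension

open Module Topology

/-- The parameters `c` for which the linear equation `L p c = τ p` has a solution `p` in a space of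
dimension smaller than the target form a set of positive codimension. -/
theorem dimH_setOf_exists_apply_eq_lt {P Q F : Type*}
    [NormedAddCommGroup P] [NormedSpace ℝ P] [FiniteDimensional ℝ P]
    [NormedAddCommGroup Q] [NormedSpace ℝ Q] [FiniteDimensional ℝ Q] [Nontrivial Q]
    [NormedAddCommGroup F] [NormedSpace ℝ F] [FiniteDimensional ℝ F]
    {L : P → Q →L[ℝ] F} (hL : ContDiff ℝ 1 L) {τ : P → F} (hτ : ContDiff ℝ 1 τ)
    {O : Set P} (hO : ∀ p ∈ O, Function.Surjective (L p)) (hdim : finrank ℝ P < finrank ℝ F) :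
    dimH {c | ∃ p ∈ O, L p c = τ p} < finrank ℝ Q := by
  have hlocal : ∀ p₀ ∈ O, ∃ N ∈ 𝓝[O] p₀,
      dimH {c | ∃ p ∈ N, L p c = τ p} ≤ (finrank ℝ Q - 1 : ℕ) := by
    intro p₀ hp₀
    obtain ⟨J₀, hJ₀⟩ := (L p₀ : Q →ₗ[ℝ] F).exists_rightInverse_of_surjective
      (LinearMap.range_eq_top.2 (hO p₀ hp₀))
    let J : F →L[ℝ] Q := LinearMap.toContinuousLinearMap J₀
    have hJ : ∀ y, L p₀ (J y) = y := fun y => LinearMap.congr_fun hJ₀ y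
    let G : P → F →L[ℝ] F := fun p => (L p).comp J
    have hG : ContDiff ℝ 1 G := hL.clm_comp contDiff_const
    have hG₀ : G p₀ = (ContinuousLinearEquiv.refl ℝ F : F →L[ℝ] F) := by
      ext y; simp [G, hJ]
    have hopen : {p | ∃ e : F ≃L[ℝ] F, (e : F →L[ℝ] F) = G p} ∈ 𝓝 p₀ := by
      have h := ContinuousLinearEquiv.nhds (ContinuousLinearEquiv.refl ℝ F)
      rw [← hG₀] at h
      exact hG.continuous.continuousAt h
    obtain ⟨ε, hε, hball⟩ := Metric.mem_nhds_iff.1 hopen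
    refine ⟨Metric.ball p₀ ε, mem_nhdsWithin_of_mem_nhds (Metric.ball_mem_nhds _ hε), ?_⟩
    let K := LinearMap.ker (L p₀ : Q →ₗ[ℝ] F)
    let Φ : P × K → Q := fun x =>
      (x.2 : Q) + J ((G x.1).inverse (τ x.1 - L x.1 (x.2 : Q)))
    let s : Set (P × K) := Metric.ball p₀ ε ×ˢ Set.univ
    have hΦ : ContDiffOn ℝ 1 Φ s := by
      rintro ⟨p, q⟩ ⟨hp, -⟩
      obtain ⟨e, he⟩ := hball hp
      have h1 : ContDiffAt ℝ 1 (fun x : P × K => (G x.1).inverse) (p, q) := by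
        have h := contDiffAt_map_inverse (𝕜 := ℝ) (n := 1) e
        rw [he] at h
        exact ContDiffAt.comp (p, q) h (hG.comp contDiff_fst).contDiffAt
      have h2 : ContDiff ℝ 1 (fun x : P × K => (x.2 : Q)) :=
        K.subtypeL.contDiff.comp contDiff_snd
      have h3 : ContDiff ℝ 1 (fun x : P × K => τ x.1 - L x.1 (x.2 : Q)) :=
        (hτ.comp contDiff_fst).sub ((hL.comp contDiff_fst).clm_apply h2)
      exact (h2.contDiffAt.add
        (J.contDiff.contDiffAt.comp (p, q) (h1.clm_apply h3.contDiffAt))).contDiffWithinAt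
    have hsub : {c | ∃ p ∈ Metric.ball p₀ ε, L p c = τ p} ⊆ Φ '' s := by
      rintro c ⟨p, hp, hc⟩
      have hk : c - J (L p₀ c) ∈ K := by simp [K, hJ]
      obtain ⟨e, he⟩ := hball hp
      refine ⟨(p, ⟨_, hk⟩), ⟨hp, trivial⟩, ?_⟩
      have h1 : τ p - L p (c - J (L p₀ c)) = G p (L p₀ c) := by
        simp [G, hc]
      simp only [Φ]
      rw [h1, ← he, ContinuousLinearMap.inverse_equiv]
      simp
    have hrank : finrank ℝ F + finrank ℝ K = finrank ℝ Q := by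
      have h := LinearMap.finrank_range_add_finrank_ker (L p₀ : Q →ₗ[ℝ] F)
      rwa [LinearMap.range_eq_top.2 (hO p₀ hp₀), finrank_top] at h
    calc _ ≤ dimH (Φ '' s) := dimH_mono hsub
      _ ≤ dimH s := hΦ.dimH_image_le ((convex_ball p₀ ε).prod convex_univ) subset_rfl
      _ ≤ dimH (Set.univ : Set (P × K)) := dimH_mono (Set.subset_univ _)
      _ = finrank ℝ (P × K) := Real.dimH_univ_eq_finrank _
      _ ≤ (finrank ℝ Q - 1 : ℕ) := by
        rw [finrank_prod]
        exact_mod_cast (by omega : finrank ℝ P + finrank ℝ K ≤ finrank ℝ Q - 1)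
  choose! N hN hNdim using hlocal
  obtain ⟨t, htO, htc, hcover⟩ := TopologicalSpace.countable_cover_nhdsWithin hN
  have hsub : {c | ∃ p ∈ O, L p c = τ p} ⊆ ⋃ p₀ ∈ t, {c | ∃ p ∈ N p₀, L p c = τ p} := by
    rintro c ⟨p, hp, hc⟩
    obtain ⟨p₀, hp₀, hpN⟩ := Set.mem_iUnion₂.1 (hcover hp)
    exact Set.mem_iUnion₂.2 ⟨p₀, hp₀, p, hpN, hc⟩
  calc _ ≤ _ := dimH_mono hsub
    _ = ⨆ p₀ ∈ t, dimH {c | ∃ p ∈ N p₀, L p c = τ p} := dimH_bUnion htc _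
    _ ≤ (finrank ℝ Q - 1 : ℕ) := iSup₂_le fun p₀ hp₀ => hNdim p₀ (htO hp₀)
    _ < finrank ℝ Q := by
      have := finrank_pos (R := ℝ) (M := Q)
      exact_mod_cast (by omega : finrank ℝ Q - 1 < finrank ℝ Q)

/-- A linear isometric action of the cyclic group of order four, given by its generator. -/
class QuarterTurn (X : Type*) [NormedAddCommGroup X] [NormedSpace ℝ X] where
  turn : X →ₗᵢ[ℝ] X
  turn_four : ∀ x, turn (turn (turn (turn x))) = x

open QuarterTurn

attribute [simp] turn_four

noncomputable instance : QuarterTurn ℝ where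
  turn := (LinearIsometryEquiv.neg ℝ).toLinearIsometry
  turn_four := by simp

noncomputable instance : QuarterTurn ℂ where
  turn :=
    { toFun := fun z => Complex.I * z
      map_add' := mul_add _
      map_smul' := fun r z => by simp; ring
      norm_map' := by simp }
  turn_four z := by
    change Complex.I * (Complex.I * (Complex.I * (Complex.I * z))) = z
    linear_combination (Complex.I ^ 2 - 1) * z * Complex.I_sq

@[simp] lemma turn_real (t : ℝ) : turn t = -t := rfl

@[simp] lemma turn_complex (z : ℂ) : turn z = Complex.I * z := rfl

section Instances

variable {X Y ι : Type*} [NormedAddCommGroup X] [NormedSpace ℝ X] [QuarterTurn X]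
  [NormedAddCommGroup Y] [NormedSpace ℝ Y] [QuarterTurn Y] [Fintype ι]

noncomputable instance : QuarterTurn (X × Y) where
  turn :=
    { toFun := fun p => (turn p.1, turn p.2)
      map_add' := by simp
      map_smul' := by simp
      norm_map' := by simp [Prod.norm_def] }
  turn_four := by simp

noncomputable instance : QuarterTurn (ι → X) where
  turn :=
    { toFun := fun v i => turn (v i)
      map_add' := fun v w => by ext; simp
      map_smul' := fun v w => by ext; simp
      norm_map' := fun v => by simp [Pi.norm_def, nnnorm] }
  turn_four v := by ext; simp

@[simp] lemma turn_prod (p : X × Y) : turn p = (turn p.1, turn p.2) := rfl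

@[simp] lemma turn_pi (v : ι → X) (i : ι) : turn v i = turn (v i) := rfl

end Instances

/-- The action on `E × ℝ` which is trivial on the second factor. -/
noncomputable def targetTurn (E : Type*) [NormedAddCommGroup E] [NormedSpace ℝ E] [QuarterTurn E] :
    E × ℝ →ₗᵢ[ℝ] E × ℝ where
  toFun p := (turn p.1, p.2)
  map_add' := by simp
  map_smul' := by simp
  norm_map' := by simp [Prod.norm_def]

section Separating

variable {X E : Type*} [NormedAddCommGroup X] [NormedSpace ℝ X] [QuarterTurn X]
  [NormedAddCommGroup E] [NormedSpace ℝ E] [QuarterTurn E]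

@[simp] lemma targetTurn_apply (p : E × ℝ) : targetTurn E p = (turn p.1, p.2) := rfl

lemma targetTurn_four (p : E × ℝ) :
    targetTurn E (targetTurn E (targetTurn E (targetTurn E p))) = p := by simp

/-- Homogeneous coordinates for an equivariant map between one-point compactifications which
preserves the origin and the point at infinity: `(a, b)` represents `0` if `a = 0 < b` and `∞` if
`a = 0 > b`. -/
structure IsSeparating (φ : X → E × ℝ) : Prop where
  continuous : Continuous φ
  map_turn : ∀ x, φ (turn x) = targetTurn E (φ x)
  ne_zero : ∀ x, φ x ≠ 0
  pos_zero : 0 < (φ 0).2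
  neg_far : ∃ R, ∀ x, R ≤ ‖x‖ → (φ x).2 < 0

lemma exists_contDiff_equivariant_approx [FiniteDimensional ℝ X] [FiniteDimensional ℝ E]
    {φ : X → E × ℝ} (hφ : Continuous φ) (hturn : ∀ x, φ (turn x) = targetTurn E (φ x))
    {ε : X → ℝ} (hε : Continuous ε) (hpos : ∀ x, 0 < ε x) (hinv : ∀ x, ε (turn x) = ε x) :
    ∃ ψ : X → E × ℝ, ContDiff ℝ 1 ψ ∧ (∀ x, ψ (turn x) = targetTurn E (ψ x)) ∧
      ∀ x, ‖ψ x - φ x‖ < ε x := by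
  obtain ⟨g, hg, happrox, -⟩ := hφ.exists_contDiff_approx 1 hε hpos
  have hg : ContDiff ℝ 1 g := hg
  let T := targetTurn E
  let t : X → X := turn
  have ht : ContDiff ℝ 1 t := (turn (X := X)).contDiff
  have hT : ContDiff ℝ 1 T := T.contDiff
  refine ⟨fun x => (1 / 4 : ℝ) • (g x + T (T (T (g (t x)))) + T (T (g (t (t x)))) +
    T (g (t (t (t x))))), ?_, fun x => ?_, fun x => ?_⟩
  · refine ContDiff.const_smul _ (((hg.add ?_).add ?_).add ?_)
    · exact hT.comp (hT.comp (hT.comp (hg.comp ht)))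
    · exact hT.comp (hT.comp (hg.comp (ht.comp ht)))
    · exact hT.comp (hg.comp (ht.comp (ht.comp ht)))
  · simp only [T, t, _root_.map_smul, map_add, targetTurn_four, turn_four]
    abel_nf
  · have key : ∀ y, ‖g y - φ y‖ < ε y := fun y => by
      rw [← dist_eq_norm]; exact happrox y
    have h1 := key (t x)
    have h2 := key (t (t x))
    have h3 := key (t (t (t x)))
    simp only [t, hturn, hinv] at h1 h2 h3
    have e1 : ‖T (T (T (g (t x)))) - φ x‖ = ‖g (t x) - T (φ x)‖ := by
      rw [← T.norm_map (g (t x) - _), ← T.norm_map (T (g (t x) - _)),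
        ← T.norm_map (T (T (g (t x) - _)))]
      simp only [map_sub, T, targetTurn_four]
    have e2 : ‖T (T (g (t (t x)))) - φ x‖ = ‖g (t (t x)) - T (T (φ x))‖ := by
      rw [← T.norm_map (g _ - _), ← T.norm_map (T (g _ - _))]
      simp only [map_sub, T, targetTurn_four]
    have e3 : ‖T (g (t (t (t x)))) - φ x‖ = ‖g (t (t (t x))) - T (T (T (φ x)))‖ := by
      rw [← T.norm_map (g _ - _)]
      simp only [map_sub, T, targetTurn_four]
    have hsum : (1 / 4 : ℝ) • (g x + T (T (T (g (t x)))) + T (T (g (t (t x)))) +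
        T (g (t (t (t x))))) - φ x = (1 / 4 : ℝ) • ((g x - φ x) +
          (T (T (T (g (t x)))) - φ x) + (T (T (g (t (t x)))) - φ x) +
          (T (g (t (t (t x)))) - φ x)) := by
      module
    rw [hsum, norm_smul]
    have := norm_add₄_le (a := g x - φ x) (b := T (T (T (g (t x)))) - φ x)
      (c := T (T (g (t (t x)))) - φ x) (d := T (g (t (t (t x)))) - φ x)
    rw [e1, e2, e3] at this
    have h0 := key x
    norm_num
    simp only [T, t] at *
    linarith

lemma IsSeparating.exists_contDiff [FiniteDimensional ℝ X] [FiniteDimensional ℝ E]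
    {φ : X → E × ℝ} (hφ : IsSeparating φ) :
    ∃ ψ : X → E × ℝ, IsSeparating ψ ∧ ContDiff ℝ 1 ψ := by
  obtain ⟨R₀, hR₀⟩ := hφ.neg_far
  set R := max R₀ 1
  have hR : ∀ x, R ≤ ‖x‖ → (φ x).2 < 0 := fun x hx => hR₀ x ((le_max_left _ _).trans hx)
  have hR1 : 0 < R := lt_of_lt_of_le one_pos (le_max_right _ _)
  have hc := hφ.continuous
  obtain ⟨ψ, hψ, hturn, happrox⟩ := exists_contDiff_equivariant_approx hφ.continuous hφ.map_turn
    (ε := fun x => min ‖φ x‖ (max |(φ x).2| (min ‖x‖ (R - ‖x‖)))) (by fun_prop)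
    (fun x => by
      refine lt_min (norm_pos_iff.2 (hφ.ne_zero x)) ?_
      rcases eq_or_ne x 0 with rfl | hx
      · exact lt_max_of_lt_left (abs_pos.2 hφ.pos_zero.ne')
      rcases lt_or_ge ‖x‖ R with h | h
      · exact lt_max_of_lt_right (lt_min (norm_pos_iff.2 hx) (by linarith))
      · exact lt_max_of_lt_left (abs_pos.2 (hR x h).ne))
    (fun x => by simp only [hφ.map_turn, LinearIsometry.norm_map]; rfl)
  have hsnd : ∀ x, |(ψ x).2 - (φ x).2| < max |(φ x).2| (min ‖x‖ (R - ‖x‖)) := fun x =>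
    ((norm_snd_le (ψ x - φ x)).trans_lt (happrox x)).trans_le (min_le_right _ _)
  refine ⟨ψ, ⟨hψ.continuous, hturn, fun x hx => ?_, ?_, R, fun x hx => ?_⟩, hψ⟩
  · have := (happrox x).trans_le (min_le_left _ _)
    simp [hx] at this
  · have := hsnd 0
    rw [max_eq_left (by simp [hR1.le]), abs_of_pos hφ.pos_zero, abs_lt] at this
    linarith
  · have := hsnd x
    rw [max_eq_left ((min_le_right _ _).trans ((sub_nonpos.2 hx).trans (abs_nonneg _))),
      abs_of_neg (hR x hx), abs_lt] at this
    linarith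

/-- A small equivariant perturbation, cut off far away from the origin, keeps all the defining
properties of a separating map. -/
lemma IsSeparating.exists_cutoff [FiniteDimensional ℝ X] {Q : Type*}
    [NormedAddCommGroup Q] [NormedSpace ℝ Q]
    {φ : X → E × ℝ} (hφ : IsSeparating φ) {L : X → Q →L[ℝ] E × ℝ} (hL : Continuous L)
    (hturn : ∀ x c, L (turn x) c = targetTurn E (L x c))
    {C : Set X} (hC : IsClosed C) {N : Set (E × ℝ)} (hN : IsClosed N)
    (hN0 : ∀ y ∈ N, 0 ≤ y.2) (hCN : ∀ x ∈ C, φ x ∉ N) :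
    ∃ χ : X → ℝ, ContDiff ℝ 1 χ ∧ ∃ R, (∀ x, ‖x‖ < R → 0 < χ x) ∧
      ∀ᶠ c in 𝓝 (0 : Q), IsSeparating (fun x => φ x + χ x • L x c) ∧
        (∀ x, R ≤ ‖x‖ → (φ x + χ x • L x c).2 < 0) ∧
        ∀ x ∈ C, φ x + χ x • L x c ∉ N := by
  obtain ⟨R₀, hR₀⟩ := hφ.neg_far
  set R := max R₀ 1
  have hR : ∀ x, R ≤ ‖x‖ → (φ x).2 < 0 := fun x hx => hR₀ x ((le_max_left _ _).trans hx)
  have hR1 : 0 < R := lt_of_lt_of_le one_pos (le_max_right _ _)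
  let f : ContDiffBump (0 : X) := ⟨R, R + 1, hR1, by linarith⟩
  let t : X → X := turn
  have htn : ∀ x, ‖t x‖ = ‖x‖ := (turn (X := X)).norm_map
  have ht : ContDiff ℝ 1 t := (turn (X := X)).contDiff
  have hf : ContDiff ℝ 1 f := f.contDiff
  let χ : X → ℝ := fun x => f x + f (t x) + f (t (t x)) + f (t (t (t x)))
  have hχ : ContDiff ℝ 1 χ :=
    ((hf.add (hf.comp ht)).add (hf.comp (ht.comp ht))).add (hf.comp (ht.comp (ht.comp ht)))
  have hχturn : ∀ x, χ (turn x) = χ x := fun x => by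
    simp only [χ, t, turn_four]; ring
  have hχpos : ∀ x, ‖x‖ < R → 0 < χ x := fun x hx => by
    have h1 : 0 < f x := f.pos_of_mem_ball (by
      simp only [f, Metric.mem_ball, dist_zero_right]; linarith)
    have := f.nonneg (x := t x)
    have := f.nonneg (x := t (t x))
    have := f.nonneg (x := t (t (t x)))
    simp only [χ]
    positivity
  have hχzero : ∀ x, R + 1 ≤ ‖x‖ → χ x = 0 := fun x hx => by
    have h : ∀ y, ‖y‖ = ‖x‖ → f y = 0 := fun y hy => f.zero_of_le_dist (by
      simpa [f, hy] using hx)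
    simp only [χ]
    rw [h _ rfl, h _ (htn _), h _ (by rw [htn, htn]), h _ (by rw [htn, htn, htn])]
    simp
  let F : Q × X → E × ℝ := fun z => φ z.2 + χ z.2 • L z.2 z.1
  have hF : Continuous F := (hφ.continuous.comp continuous_snd).add
    ((hχ.continuous.comp continuous_snd).smul
      ((hL.comp continuous_snd).clm_apply continuous_fst))
  have hF0 : ∀ x, F (0, x) = φ x := fun x => by simp [F]
  have tube : ∀ (K : Set X) (A : Set (E × ℝ)), IsCompact K → IsOpen A → (∀ x ∈ K, φ x ∈ A) →
      ∀ᶠ c in 𝓝 (0 : Q), ∀ x ∈ K, F (c, x) ∈ A := fun K A hK hA hKA =>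
    hK.eventually_forall_of_forall_eventually fun x hx =>
      hF.continuousAt.eventually_mem (hA.mem_nhds (by rw [hF0]; exact hKA x hx))
  have hball := isCompact_closedBall (0 : X) (R + 1)
  have hneg : IsOpen {y : E × ℝ | y.2 < 0} := isOpen_lt continuous_snd continuous_const
  refine ⟨χ, hχ, R, hχpos, ?_⟩
  filter_upwards [tube _ {0}ᶜ hball isOpen_compl_singleton (fun x _ => hφ.ne_zero x),
    tube _ {y | y.2 < 0} (hball.inter_right (isClosed_le continuous_const continuous_norm :
      IsClosed {x : X | R ≤ ‖x‖})) hneg (fun x hx => hR x hx.2),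
    tube {0} {y | 0 < y.2} isCompact_singleton (isOpen_lt continuous_const continuous_snd)
      (by simpa using hφ.pos_zero),
    tube _ Nᶜ (hball.inter_right hC) hN.isOpen_compl (fun x hx => hCN x hx.2)]
    with c h1 h2 h3 h4
  have hfar : ∀ x, R ≤ ‖x‖ → (φ x + χ x • L x c).2 < 0 := fun x hx => by
    rcases le_or_gt ‖x‖ (R + 1) with h | h
    · exact h2 x ⟨by simpa using h, hx⟩
    · rw [hχzero x h.le]; simpa using hR x hx
  refine ⟨⟨hF.comp (Continuous.prodMk continuous_const continuous_id), fun x => ?_, fun x hx => ?_,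
    h3 0 rfl, R, hfar⟩, hfar, fun x hx hxN => ?_⟩
  · simp only [hφ.map_turn, hturn, hχturn, map_add, _root_.map_smul]
  · rcases le_or_gt ‖x‖ R with h | h
    · exact h1 x (by simpa using h.trans (by linarith)) hx
    · have := hfar x h.le
      simp [hx] at this
  · rcases le_or_gt ‖x‖ R with h | h
    · exact h4 x ⟨by simpa using h.trans (by linarith), hx⟩ hxN
    · exact absurd (hN0 _ hxN) (hfar x h.le).not_ge

end Separating

/-- The projection `(V × W) × ℝ → V × ℝ` forgetting the suspension coordinate `W`. -/
def dropMiddle (V W : Type*) [NormedAddCommGroup V] [NormedSpace ℝ V]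
    [NormedAddCommGroup W] [NormedSpace ℝ W] : (V × W) × ℝ →L[ℝ] V × ℝ :=
  ((ContinuousLinearMap.fst ℝ V W).comp (ContinuousLinearMap.fst ℝ (V × W) ℝ)).prod
    (ContinuousLinearMap.snd ℝ (V × W) ℝ)

@[simp] lemma dropMiddle_apply {V W : Type*} [NormedAddCommGroup V] [NormedSpace ℝ V]
    [NormedAddCommGroup W] [NormedSpace ℝ W] (y : (V × W) × ℝ) :
    dropMiddle V W y = (y.1.1, y.2) := rfl

section Generic

variable {U V W Q P₀ F₀ : Type*}
  [NormedAddCommGroup U] [NormedSpace ℝ U] [QuarterTurn U]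
  [NormedAddCommGroup V] [NormedSpace ℝ V] [QuarterTurn V]
  [NormedAddCommGroup W] [NormedSpace ℝ W] [QuarterTurn W]
  [NormedAddCommGroup Q] [NormedSpace ℝ Q]
  [NormedAddCommGroup P₀] [NormedSpace ℝ P₀]
  [NormedAddCommGroup F₀] [NormedSpace ℝ F₀]

variable (U V W Q P₀ F₀) in
/-- A finite-dimensional family of equivariant maps `U × W → (V × W) × ℝ` which is large enough for
general position arguments: it separates two points of a fibre over the set `free`, and the fibres
over the complement of `free` lie in the image of a space `P₀` on which the family is
surjective onto a quotient `F₀` of `V × ℝ` of larger dimension. -/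
structure PerturbationFamily where
  toFun : U × W → Q →L[ℝ] (V × W) × ℝ
  contDiff : ContDiff ℝ 1 toFun
  map_turn : ∀ x c, toFun (turn x) c = targetTurn (V × W) (toFun x c)
  free : Set U
  pair_surjective : ∀ u ∈ free, ∀ w w', w ≠ w' →
    Function.Surjective fun c => (toFun (u, w) c, toFun (u, w') c)
  incl : P₀ →L[ℝ] U × W
  proj : V × ℝ →L[ℝ] F₀
  exists_incl : ∀ u ∉ free, ∀ w, ∃ p, incl p = (u, w)
  proj_surjective : ∀ p ≠ 0,
    Function.Surjective fun c => proj (dropMiddle V W (toFun (incl p) c))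
  finrank_lt : finrank ℝ P₀ < finrank ℝ F₀
  finiteDimensional : FiniteDimensional ℝ Q
  nontrivial : Nontrivial Q

/-- General position: after a small perturbation, a separating map has no zeros (modulo the
suspension coordinate) outside the free part, and the pairs of zeros in a common fibre avoid any
finite number of linear conditions that are too many for a given family of pairs. -/
theorem PerturbationFamily.exists_generic
    [FiniteDimensional ℝ U] [FiniteDimensional ℝ W]
    [FiniteDimensional ℝ P₀] [FiniteDimensional ℝ F₀]
    (𝓛 : PerturbationFamily U V W Q P₀ F₀)
    {φ : U × W → (V × W) × ℝ} (hφ : IsSeparating φ) (hφ1 : ContDiff ℝ 1 φ)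
    {ι P F : Type*} [Finite ι] [NormedAddCommGroup P] [NormedSpace ℝ P] [FiniteDimensional ℝ P]
    [NormedAddCommGroup F] [NormedSpace ℝ F] [FiniteDimensional ℝ F]
    (q : ι → P → U × W × W) (hq : ∀ i, ContDiff ℝ 1 (q i))
    (Λ : ι → ((V × W) × ℝ) × ((V × W) × ℝ) →L[ℝ] F) (hΛ : ∀ i, Function.Surjective (Λ i))
    (hdim : finrank ℝ P < finrank ℝ F)
    {C : Set (U × W)} (hC : IsClosed C) {N : Set ((V × W) × ℝ)} (hN : IsClosed N)
    (hN0 : ∀ y ∈ N, 0 ≤ y.2) (hCN : ∀ x ∈ C, φ x ∉ N) :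
    ∃ ψ : U × W → (V × W) × ℝ, IsSeparating ψ ∧ ContDiff ℝ 1 ψ ∧ (∀ x ∈ C, ψ x ∉ N) ∧
      (∀ u ∉ 𝓛.free, ∀ w, dropMiddle V W (ψ (u, w)) ≠ 0) ∧
      ∀ i p, (q i p).1 ∈ 𝓛.free → (q i p).2.1 ≠ (q i p).2.2 →
        dropMiddle V W (ψ ((q i p).1, (q i p).2.1)) = 0 →
        dropMiddle V W (ψ ((q i p).1, (q i p).2.2)) = 0 →
        Λ i (ψ ((q i p).1, (q i p).2.1), ψ ((q i p).1, (q i p).2.2)) ≠ 0 := by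
  have := 𝓛.finiteDimensional
  have := 𝓛.nontrivial
  obtain ⟨χ, hχ, R, hχpos, hsmall⟩ :=
    hφ.exists_cutoff 𝓛.contDiff.continuous 𝓛.map_turn hC hN hN0 hCN
  set M : U × W → Q →L[ℝ] (V × W) × ℝ := fun x => χ x • 𝓛.toFun x
  have hM : ContDiff ℝ 1 M := hχ.smul 𝓛.contDiff
  let D := dropMiddle V W
  let bad₀ : Set Q := {c | ∃ p ∈ {p : P₀ | p ≠ 0 ∧ ‖𝓛.incl p‖ < R},
    (𝓛.proj.comp D).comp (M (𝓛.incl p)) c = -(𝓛.proj.comp D) (φ (𝓛.incl p))}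
  have hbad₀ : dimH bad₀ < finrank ℝ Q := by
    refine dimH_setOf_exists_apply_eq_lt
      (L := fun p => (𝓛.proj.comp D).comp (M (𝓛.incl p)))
      (contDiff_const.clm_comp (hM.comp 𝓛.incl.contDiff))
      (((𝓛.proj.comp D).contDiff.comp (hφ1.comp 𝓛.incl.contDiff)).neg) ?_ 𝓛.finrank_lt
    rintro p ⟨hp, hpR⟩ y
    obtain ⟨c, hc⟩ := 𝓛.proj_surjective p hp y
    have hne := (hχpos _ hpR).ne'
    refine ⟨(χ (𝓛.incl p))⁻¹ • c, ?_⟩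
    change 𝓛.proj (D (χ (𝓛.incl p) • 𝓛.toFun (𝓛.incl p) ((χ (𝓛.incl p))⁻¹ • c))) = y
    rw [(𝓛.toFun (𝓛.incl p)).map_smul, smul_inv_smul₀ hne]
    exact hc
  let x₁ : ι → P → U × W := fun i p => ((q i p).1, (q i p).2.1)
  let x₂ : ι → P → U × W := fun i p => ((q i p).1, (q i p).2.2)
  have hx₁ : ∀ i, ContDiff ℝ 1 (x₁ i) := fun i => (hq i).fst.prodMk (hq i).snd.fst
  have hx₂ : ∀ i, ContDiff ℝ 1 (x₂ i) := fun i => (hq i).fst.prodMk (hq i).snd.snd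
  let O : ι → Set P := fun i => {p | (q i p).1 ∈ 𝓛.free ∧ (q i p).2.1 ≠ (q i p).2.2 ∧
    ‖x₁ i p‖ < R ∧ ‖x₂ i p‖ < R}
  let bad : ι → Set Q := fun i => {c | ∃ p ∈ O i,
    (Λ i).comp ((M (x₁ i p)).prod (M (x₂ i p))) c = -(Λ i) (φ (x₁ i p), φ (x₂ i p))}
  have hbad : ∀ i, dimH (bad i) < finrank ℝ Q := by
    intro i
    refine dimH_setOf_exists_apply_eq_lt
      (L := fun p => (Λ i).comp ((M (x₁ i p)).prod (M (x₂ i p)))) ?_ ?_ ?_ hdim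
    · refine contDiff_const.clm_comp ?_
      rw [contDiff_clm_apply_iff]
      intro c
      exact ((hM.comp (hx₁ i)).clm_apply contDiff_const).prodMk
        ((hM.comp (hx₂ i)).clm_apply contDiff_const)
    · exact ((Λ i).contDiff.comp ((hφ1.comp (hx₁ i)).prodMk (hφ1.comp (hx₂ i)))).neg
    · rintro p ⟨hp, hpw, h1, h2⟩ y
      obtain ⟨⟨y₁, y₂⟩, rfl⟩ := hΛ i y
      have hne₁ := (hχpos _ h1).ne'
      have hne₂ := (hχpos _ h2).ne'
      obtain ⟨c, hc⟩ := 𝓛.pair_surjective _ hp _ _ hpw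
        ((χ (x₁ i p))⁻¹ • y₁, (χ (x₂ i p))⁻¹ • y₂)
      refine ⟨c, ?_⟩
      change Λ i (χ (x₁ i p) • 𝓛.toFun (x₁ i p) c, χ (x₂ i p) • 𝓛.toFun (x₂ i p) c) = _
      obtain ⟨hc₁, hc₂⟩ := Prod.mk.inj hc
      rw [hc₁, hc₂, smul_inv_smul₀ hne₁, smul_inv_smul₀ hne₂]
  have hall : dimH (bad₀ ∪ ⋃ i, bad i) < finrank ℝ Q := by
    rw [dimH_union, dimH_iUnion]
    refine max_lt hbad₀ ?_
    rcases isEmpty_or_nonempty ι with h | h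
    · simpa using finrank_pos (R := ℝ) (M := Q)
    · obtain ⟨i, hi⟩ := exists_eq_ciSup_of_finite (f := fun i => dimH (bad i))
      rw [← hi]
      exact hbad i
  obtain ⟨c, hc, hsep, hfar, hcC⟩ :=
    ((dense_compl_of_dimH_lt_finrank hall).inter_nhds_nonempty hsmall)
  simp only [Set.mem_compl_iff, Set.mem_union, Set.mem_iUnion, not_or, not_exists] at hc
  have hnear : ∀ x, dropMiddle V W (φ x + χ x • 𝓛.toFun x c) = 0 → ‖x‖ < R := by
    intro x hx
    by_contra! h
    exact (hfar x h).ne (congrArg Prod.snd hx)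
  refine ⟨fun x => φ x + χ x • 𝓛.toFun x c, hsep,
    hφ1.add (hχ.smul (𝓛.contDiff.clm_apply contDiff_const)), hcC, fun u hu w h0 => ?_,
    fun i p hp hpw h1 h2 h => hc.2 i ⟨p, ⟨hp, hpw, hnear _ h1, hnear _ h2⟩, ?_⟩⟩
  · obtain ⟨p, hp⟩ := 𝓛.exists_incl u hu w
    have hlt := hnear _ h0
    rw [← hp] at h0 hlt
    have hp0 : p ≠ 0 := by
      rintro rfl
      rw [map_zero] at h0
      exact hsep.pos_zero.ne' (congrArg Prod.snd h0)
    refine hc.1 ⟨p, ⟨hp0, hlt⟩, ?_⟩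
    rw [eq_neg_iff_add_eq_zero, add_comm]
    have := congrArg 𝓛.proj h0
    rw [map_add, map_add, map_zero] at this
    exact this
  · rw [eq_neg_iff_add_eq_zero, add_comm]
    have : Λ i ((φ (x₁ i p), φ (x₂ i p)) + (M (x₁ i p) c, M (x₂ i p) c)) = 0 := h
    rw [map_add] at this
    exact this

end Generic

section Section

variable {U V W : Type*}
  [NormedAddCommGroup U] [NormedSpace ℝ U] [QuarterTurn U]
  [NormedAddCommGroup V] [NormedSpace ℝ V] [QuarterTurn V]
  [NormedAddCommGroup W] [NormedSpace ℝ W] [QuarterTurn W]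

@[simp] lemma turn_eq_zero_iff (v : V) : turn v = 0 ↔ v = 0 := by
  rw [← norm_eq_zero, LinearIsometry.norm_map, norm_eq_zero]

lemma IsSeparating.exists_bound {φ : U → V × ℝ} (hφ : IsSeparating φ) :
    ∃ R > 0, ∀ x, (φ x).2 = 0 → ‖x‖ < R := by
  obtain ⟨R, hR⟩ := hφ.neg_far
  refine ⟨max R 1, lt_max_of_lt_right one_pos, fun x hx => ?_⟩
  by_contra! h
  exact (hR x ((le_max_left _ _).trans h)).ne hx

lemma IsSeparating.isCompact_preimage [FiniteDimensional ℝ U] {φ : U → V × ℝ}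
    (hφ : IsSeparating φ) {S : Set (V × ℝ)} (hS : IsClosed S) (hS0 : ∀ y ∈ S, y.2 = 0) :
    IsCompact (φ ⁻¹' S) := by
  obtain ⟨R, -, hR⟩ := hφ.exists_bound
  refine Metric.isCompact_of_isClosed_isBounded (hS.preimage hφ.continuous) ?_
  refine (Metric.isBounded_ball (x := (0 : U)) (r := R)).subset fun x hx => ?_
  simpa using hR x (hS0 _ hx)

/-- Restricting to the graph of an equivariant map that avoids the zeros modulo `W`. -/
lemma IsSeparating.comp_graph {φ : U × W → (V × W) × ℝ} (hφ : IsSeparating φ) {h : U → W}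
    (hc : Continuous h) (hturn : ∀ u, h (turn u) = turn (h u)) (h0 : h 0 = 0)
    (hne : ∀ u, dropMiddle V W (φ (u, h u)) ≠ 0) :
    IsSeparating fun u => dropMiddle V W (φ (u, h u)) where
  continuous := (dropMiddle V W).continuous.comp
    (hφ.continuous.comp (continuous_id.prodMk hc))
  map_turn u := by
    have := hφ.map_turn (u, h u)
    rw [turn_prod] at this
    simp [hturn, this]
  ne_zero := hne
  pos_zero := by
    rw [h0]
    exact hφ.pos_zero
  neg_far := by
    obtain ⟨R, hR⟩ := hφ.neg_far
    exact ⟨R, fun u hu => hR _ (hu.trans (norm_fst_le (u, h u)))⟩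

lemma IsSeparating.dropMiddle_turn_eq_zero {φ : U × W → (V × W) × ℝ} (hφ : IsSeparating φ)
    {x : U × W} (hx : dropMiddle V W (φ x) = 0) : dropMiddle V W (φ (turn x)) = 0 := by
  rw [hφ.map_turn]
  simpa using hx

lemma IsSeparating.middle_turn {φ : U × W → (V × W) × ℝ} (hφ : IsSeparating φ) (x : U × W) :
    (φ (turn x)).1.2 = turn (φ x).1.2 := by
  rw [hφ.map_turn]
  rfl

lemma IsSeparating.middle_ne_zero {φ : U × W → (V × W) × ℝ} (hφ : IsSeparating φ) {x : U × W}
    (hx : dropMiddle V W (φ x) = 0) : (φ x).1.2 ≠ 0 := by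
  intro h
  rw [dropMiddle_apply, Prod.mk_eq_zero] at hx
  exact hφ.ne_zero x (Prod.ext (Prod.ext hx.1 h) hx.2)

end Section

section RealStep

variable {U V Q P₀ F₀ : Type*}
  [NormedAddCommGroup U] [NormedSpace ℝ U] [QuarterTurn U]
  [NormedAddCommGroup V] [NormedSpace ℝ V] [QuarterTurn V]
  [NormedAddCommGroup Q] [NormedSpace ℝ Q]
  [NormedAddCommGroup P₀] [NormedSpace ℝ P₀]
  [NormedAddCommGroup F₀] [NormedSpace ℝ F₀]
  [FiniteDimensional ℝ U]

lemma dropMiddle_surjective (V W : Type*) [NormedAddCommGroup V] [NormedSpace ℝ V]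
    [NormedAddCommGroup W] [NormedSpace ℝ W] : Function.Surjective (dropMiddle V W) :=
  fun y => ⟨((y.1, 0), y.2), rfl⟩

/-- If zeros are unique in each fibre, then the suspension coordinate `ℝ` can be removed. -/
lemma IsSeparating.exists_of_unique_zero_real {φ : U × ℝ → (V × ℝ) × ℝ} (hφ : IsSeparating φ)
    (huniq : ∀ u w w', dropMiddle V ℝ (φ (u, w)) = 0 → dropMiddle V ℝ (φ (u, w')) = 0 → w = w') :
    ∃ ψ : U → V × ℝ, IsSeparating ψ := by
  obtain ⟨R, hR0, hR⟩ := hφ.exists_bound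
  let A : Set ((V × ℝ) × ℝ) := {y | dropMiddle V ℝ y = 0 ∧ 0 ≤ y.1.2}
  let B : Set ((V × ℝ) × ℝ) := {y | dropMiddle V ℝ y = 0 ∧ y.1.2 ≤ 0}
  have ha : Continuous fun y : (V × ℝ) × ℝ => y.1.2 := by fun_prop
  have hA : IsClosed A := (isClosed_eq (dropMiddle V ℝ).continuous continuous_const).inter
    (isClosed_le continuous_const ha)
  have hB : IsClosed B := (isClosed_eq (dropMiddle V ℝ).continuous continuous_const).inter
    (isClosed_le ha continuous_const)
  let KA := Prod.fst '' (φ ⁻¹' A)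
  let KB := Prod.fst '' (φ ⁻¹' B)
  have hKA : IsCompact KA :=
    (hφ.isCompact_preimage hA fun y hy => congrArg Prod.snd hy.1).image continuous_fst
  have hKB : IsCompact KB :=
    (hφ.isCompact_preimage hB fun y hy => congrArg Prod.snd hy.1).image continuous_fst
  have hdisj : Disjoint KB KA := by
    rw [Set.disjoint_left]
    rintro _ ⟨⟨u, w⟩, hw, rfl⟩ ⟨⟨u', w'⟩, hw', rfl⟩
    obtain rfl : w = w' := huniq _ _ _ hw.1 hw'.1
    refine hφ.ne_zero (u', w) ?_
    have h1 := hw.1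
    rw [dropMiddle_apply, Prod.mk_eq_zero] at h1
    exact Prod.ext (Prod.ext h1.1 (le_antisymm hw.2 hw'.2)) h1.2
  have hAB : ∀ u ∈ KA, turn u ∈ KB := by
    rintro _ ⟨x, hx, rfl⟩
    refine ⟨turn x, ?_, rfl⟩
    rw [Set.mem_preimage, hφ.map_turn]
    simpa [A, B] using hx
  have hBA : ∀ u ∈ KB, turn u ∈ KA := by
    rintro _ ⟨x, hx, rfl⟩
    refine ⟨turn x, ?_, rfl⟩
    rw [Set.mem_preimage, hφ.map_turn]
    simpa [A, B] using hx
  obtain ⟨g, hg0, hg1, -⟩ :=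
    exists_continuous_zero_one_of_isClosed hKB.isClosed hKA.isClosed hdisj
  have ht : Continuous (turn : U → U) := (turn (X := U)).continuous
  let h : U → ℝ := fun u =>
    R * (g u - g (turn u) + g (turn (turn u)) - g (turn (turn (turn u))))
  have hturn : ∀ u, h (turn u) = turn (h u) := fun u => by simp [h]; ring
  have hzero : h 0 = 0 := by simp [h]
  refine ⟨_, hφ.comp_graph (h := h) (by fun_prop) hturn hzero fun u hu => ?_⟩
  have hlt : |h u| < R :=
    lt_of_le_of_lt (norm_snd_le (u, h u)) (hR _ (congrArg Prod.snd hu))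
  rcases le_total 0 (φ (u, h u)).1.2 with hs | hs
  · have h1 : u ∈ KA := ⟨_, ⟨hu, hs⟩, rfl⟩
    have h2 := hAB _ h1
    have h3 := hBA _ h2
    have h4 := hAB _ h3
    have : h u = R * 2 := by
      simp only [h, hg1 h1, hg0 h2, hg1 h3, hg0 h4, Pi.one_apply, Pi.zero_apply]
      norm_num
    rw [this, abs_lt] at hlt
    linarith
  · have h1 : u ∈ KB := ⟨_, ⟨hu, hs⟩, rfl⟩
    have h2 := hBA _ h1
    have h3 := hAB _ h2
    have h4 := hBA _ h3
    have : h u = -(R * 2) := by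
      simp only [h, hg0 h1, hg1 h2, hg0 h3, hg1 h4, Pi.one_apply, Pi.zero_apply]
      ring
    rw [this, abs_lt] at hlt
    linarith

theorem PerturbationFamily.desuspend_real [FiniteDimensional ℝ V]
    [FiniteDimensional ℝ P₀] [FiniteDimensional ℝ F₀]
    (𝓛 : PerturbationFamily U V ℝ Q P₀ F₀)
    (hdim : finrank ℝ U < 2 * finrank ℝ V) {φ : U × ℝ → (V × ℝ) × ℝ} (hφ : IsSeparating φ) :
    ∃ ψ : U → V × ℝ, IsSeparating ψ := by
  obtain ⟨φ₁, hφ₁, hsmooth⟩ := hφ.exists_contDiff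
  obtain ⟨ψ, hψ, -, -, hfree, hpair⟩ := 𝓛.exists_generic hφ₁ hsmooth (ι := Unit)
    (P := U × ℝ × ℝ) (F := (V × ℝ) × (V × ℝ)) (fun _ => id) (fun _ => contDiff_id)
    (fun _ => (dropMiddle V ℝ).prodMap (dropMiddle V ℝ))
    (fun _ => (dropMiddle_surjective V ℝ).prodMap (dropMiddle_surjective V ℝ))
    (by simp only [finrank_prod, finrank_self]; omega)
    isClosed_empty isClosed_empty (by simp) (by simp)
  refine hψ.exists_of_unique_zero_real fun u w w' hw hw' => ?_
  by_contra hne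
  by_cases hu : u ∈ 𝓛.free
  · exact hpair () (u, w, w') hu hne hw hw' (Prod.ext hw hw')
  · exact hfree u hu w hw

end RealStep

section Rotation

variable {U : Type*} [NormedAddCommGroup U] [NormedSpace ℝ U] [QuarterTurn U]

/-- A compact set which is disjoint from its translates is mapped to `1` by some equivariant map
to `ℂ`. -/
lemma exists_contDiff_equivariant_eq_one [FiniteDimensional ℝ U] {K : Set U} (hK : IsCompact K)
    (h1 : ∀ u ∈ K, turn u ∉ K) (h2 : ∀ u ∈ K, turn (turn u) ∉ K) :
    ∃ h : U → ℂ, ContDiff ℝ 1 h ∧ (∀ u, h (turn u) = turn (h u)) ∧ ∀ u ∈ K, h u = 1 := by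
  have ht : ContDiff ℝ 1 (turn : U → U) := (turn (X := U)).contDiff
  have htc : Continuous (turn : U → U) := ht.continuous
  have h3 : ∀ u ∈ K, turn (turn (turn u)) ∉ K := fun u hu h => h1 _ h (by simpa using hu)
  let S : Set U := {u | turn u ∈ K} ∪ {u | turn (turn u) ∈ K} ∪ {u | turn (turn (turn u)) ∈ K}
  have hS : IsClosed S := ((hK.isClosed.preimage htc).union
    (hK.isClosed.preimage (htc.comp htc))).union (hK.isClosed.preimage (htc.comp (htc.comp htc)))
  have hdisj : Disjoint S K := by
    rw [Set.disjoint_right]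
    rintro u hu ((h | h) | h)
    exacts [h1 u hu h, h2 u hu h, h3 u hu h]
  obtain ⟨χ, hχ0, hχ1, -⟩ := exists_contMDiffMap_zero_one_of_isClosed (n := 1)
    (modelWithCornersSelf ℝ U) hS hK.isClosed hdisj
  have hχ : ContDiff ℝ 1 χ := χ.contMDiff.contDiff
  have hof : ∀ g : U → ℝ, ContDiff ℝ 1 g → ContDiff ℝ 1 fun u => (g u : ℂ) :=
    fun g hg => Complex.ofRealCLM.contDiff.comp hg
  refine ⟨fun u => χ u + Complex.I * χ (turn (turn (turn u))) - χ (turn (turn u)) -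
    Complex.I * χ (turn u), ?_, fun u => ?_, fun u hu => ?_⟩
  · exact (((hof _ hχ).add (contDiff_const.mul (hof _ (hχ.comp (ht.comp (ht.comp ht)))))).sub
      (hof _ (hχ.comp (ht.comp ht)))).sub (contDiff_const.mul (hof _ (hχ.comp ht)))
  · simp only [turn_four, turn_complex]
    linear_combination (χ (turn u) - χ (turn (turn (turn u))) : ℂ) * Complex.I_sq
  · have e1 : χ (turn u) = 0 := hχ0 (Or.inr (by simpa using hu))
    have e2 : χ (turn (turn u)) = 0 := hχ0 (Or.inl (Or.inr (by simpa using hu)))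
    have e3 : χ (turn (turn (turn u))) = 0 := hχ0 (Or.inl (Or.inl (by simpa using hu)))
    have e0 : χ u = 1 := hχ1 hu
    simp [e0, e1, e2, e3]

/-- The union of the two coordinate axes of `ℂ`. -/
def axes : Set ℂ := {z | z.re = 0 ∨ z.im = 0}

lemma isClosed_axes : IsClosed axes :=
  (isClosed_eq Complex.continuous_re continuous_const).union
    (isClosed_eq Complex.continuous_im continuous_const)

@[simp] lemma I_mul_mem_axes {z : ℂ} : Complex.I * z ∈ axes ↔ z ∈ axes := by
  simp [axes, or_comm]

/-- An equivariant map of `ℂ` to the union of its coordinate axes. -/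
noncomputable def toAxes (z : ℂ) : ℂ :=
  ⟨z.re - max (-|z.im|) (min |z.im| z.re), z.im - max (-|z.re|) (min |z.re| z.im)⟩

lemma continuous_toAxes : Continuous toAxes :=
  Complex.equivRealProdCLM.symm.continuous.comp
    (f := fun z : ℂ => (z.re - max (-|z.im|) (min |z.im| z.re),
      z.im - max (-|z.re|) (min |z.re| z.im))) (by fun_prop)

lemma toAxes_I_mul (z : ℂ) : toAxes (Complex.I * z) = Complex.I * toAxes z := by
  apply Complex.ext
  · simp only [toAxes, Complex.mul_re, Complex.mul_im, Complex.I_re, Complex.I_im]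
    rw [show (0 * z.re - 1 * z.im) = -z.im by ring, show 0 * z.im + 1 * z.re = z.re by ring]
    have := abs_nonneg z.re
    simp only [max_def, min_def]
    split_ifs <;> linarith
  · simp [toAxes]

lemma toAxes_mem_axes (z : ℂ) : toAxes z ∈ axes := by
  rcases le_total |z.re| |z.im| with h | h
  · left
    simp [toAxes, (abs_le.1 h).1, (abs_le.1 h).2]
  · right
    simp [toAxes, (abs_le.1 h).1, (abs_le.1 h).2]

@[simp] lemma toAxes_one : toAxes 1 = 1 := by
  apply Complex.ext <;> simp [toAxes]

lemma exists_rotate_mem_quadrant {α : Type*} {T : α → α} {a : α → ℂ}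
    (hT : ∀ x, a (T x) = Complex.I * a x) {p : α → Prop} (hp : ∀ x, p x → p (T x)) {x : α}
    (hx : p x) : ∃ y, p y ∧ 0 ≤ (a y).re ∧ 0 ≤ (a y).im := by
  rcases le_total 0 (a x).re with hr | hr <;> rcases le_total 0 (a x).im with hi | hi
  · exact ⟨x, hx, hr, hi⟩
  · exact ⟨_, hp _ hx, by simp [hT, hr, hi]⟩
  · exact ⟨_, hp _ (hp _ (hp _ hx)), by simp [hT, hr, hi]⟩
  · exact ⟨_, hp _ (hp _ hx), by simp [hT, hr, hi]⟩

lemma exists_rotate_mem_ray {α : Type*} {T : α → α} {a : α → ℂ}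
    (hT : ∀ x, a (T x) = Complex.I * a x) {p : α → Prop} (hp : ∀ x, p x → p (T x)) {x : α}
    (hx : p x) (hax : a x ∈ axes) : ∃ y, p y ∧ 0 ≤ (a y).re ∧ (a y).im = 0 := by
  obtain ⟨y, ⟨hy, hay⟩, hr, hi⟩ := exists_rotate_mem_quadrant hT (p := fun x => p x ∧ a x ∈ axes)
    (fun x hx => ⟨hp _ hx.1, by simpa [hT] using hx.2⟩) ⟨hx, hax⟩
  rcases hay with h | h
  · exact ⟨_, hp _ (hp _ (hp _ hy)), by simp [hT, h, hi]⟩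
  · exact ⟨y, hy, hr, h⟩

/-- The union of the two diagonals of `ℂ`. -/
def diagonals : Set ℂ := {z | z.re ^ 2 = z.im ^ 2}

lemma isClosed_diagonals : IsClosed diagonals :=
  isClosed_eq (by fun_prop) (by fun_prop)

@[simp] lemma I_mul_mem_diagonals {z : ℂ} : Complex.I * z ∈ diagonals ↔ z ∈ diagonals := by
  simp [diagonals, eq_comm]

/-- Generators of the two diagonals of `ℂ`. -/
def diagonalVector (b : Bool) : ℂ := if b then ⟨1, 1⟩ else ⟨1, -1⟩

lemma exists_smul_diagonalVector {z : ℂ} (hz : z ∈ diagonals) :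
    ∃ b, ∃ t : ℝ, z = t • diagonalVector b := by
  rcases sq_eq_sq_iff_eq_or_eq_neg.1 hz with h | h
  · exact ⟨true, z.re, by apply Complex.ext <;> simp [diagonalVector, h]⟩
  · exact ⟨false, z.re, by apply Complex.ext <;> simp [diagonalVector, h]⟩

lemma diagonalVector_mul_mem_diagonals {z : ℂ} (hz : z ∈ axes) :
    diagonalVector true * z ∈ diagonals := by
  rcases hz with h | h <;> simp [diagonalVector, diagonals, h]

end Rotation

/-- The projection of `(V × ℂ) × ℝ` to `V × ℝ` and the real or imaginary part of the middle
coordinate. -/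
noncomputable def dropPart (V : Type*) [NormedAddCommGroup V] [NormedSpace ℝ V] (b : Bool) :
    (V × ℂ) × ℝ →L[ℝ] (V × ℝ) × ℝ :=
  (dropMiddle V ℂ).prod ((if b then Complex.reCLM else Complex.imCLM).comp
    ((ContinuousLinearMap.snd ℝ V ℂ).comp (ContinuousLinearMap.fst ℝ (V × ℂ) ℝ)))

lemma dropPart_surjective (V : Type*) [NormedAddCommGroup V] [NormedSpace ℝ V] (b : Bool) :
    Function.Surjective (dropPart V b) := by
  rintro ⟨⟨v, r⟩, t⟩
  exact ⟨((v, ⟨t, t⟩), r), by cases b <;> rfl⟩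

lemma exists_dropPart_eq_zero {V : Type*} [NormedAddCommGroup V] [NormedSpace ℝ V]
    {y : (V × ℂ) × ℝ} (h0 : dropMiddle V ℂ y = 0)
    (hy : y.1.2 ∈ axes) : ∃ b, dropPart V b y = 0 := by
  rcases hy with h | h
  · exact ⟨true, Prod.ext h0 h⟩
  · exact ⟨false, Prod.ext h0 h⟩

section ComplexStep

variable {U V Q P₀ F₀ : Type*}
  [NormedAddCommGroup U] [NormedSpace ℝ U] [QuarterTurn U]
  [NormedAddCommGroup V] [NormedSpace ℝ V] [QuarterTurn V]
  [NormedAddCommGroup Q] [NormedSpace ℝ Q]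
  [NormedAddCommGroup P₀] [NormedSpace ℝ P₀]
  [NormedAddCommGroup F₀] [NormedSpace ℝ F₀]
  [FiniteDimensional ℝ U]

/-- If two different zeros of a fibre never both have suspension coordinate on the axes, then some
equivariant family of crosses avoids the zeros with suspension coordinate on the axes. -/
lemma IsSeparating.exists_cross {φ : U × ℂ → (V × ℂ) × ℝ} (hφ : IsSeparating φ)
    (huniq : ∀ u w w', dropMiddle V ℂ (φ (u, w)) = 0 → dropMiddle V ℂ (φ (u, w')) = 0 →
      (φ (u, w)).1.2 ∈ axes → (φ (u, w')).1.2 ∈ axes → w = w') :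
    ∃ h : U → ℂ, ContDiff ℝ 1 h ∧ (∀ u, h (turn u) = turn (h u)) ∧
      ∀ u, ∀ s ∈ diagonals, dropMiddle V ℂ (φ (u, h u + s)) = 0 →
        (φ (u, h u + s)).1.2 ∉ axes := by
  obtain ⟨R, hR0, hR⟩ := hφ.exists_bound
  let S : Set ((V × ℂ) × ℝ) := {y | dropMiddle V ℂ y = 0 ∧ 0 ≤ y.1.2.re ∧ y.1.2.im = 0}
  have hS : IsClosed S :=
    (isClosed_eq (dropMiddle V ℂ).continuous continuous_const).inter
      ((isClosed_le continuous_const (g := fun y : (V × ℂ) × ℝ => y.1.2.re) (by fun_prop)).inter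
        (isClosed_eq (f := fun y : (V × ℂ) × ℝ => y.1.2.im) (by fun_prop) continuous_const))
  let K := Prod.fst '' (φ ⁻¹' S)
  have hK : IsCompact K :=
    (hφ.isCompact_preimage hS fun y hy => congrArg Prod.snd hy.1).image continuous_fst
  have hret : ∀ x : U × ℂ, ∀ w, dropMiddle V ℂ (φ x) = 0 → (φ x).1.2 ∈ axes →
      φ (x.1, w) ∈ S → (φ x).1.2 = (φ (x.1, w)).1.2 := by
    rintro ⟨u, w'⟩ w h0 hax ⟨hw0, hw⟩
    rw [huniq u w' w h0 hw0 hax (Or.inr hw.2)]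
  have hray : ∀ {z : ℂ}, z.im = 0 → z ∈ axes := fun h => Or.inr h
  have h1 : ∀ u ∈ K, turn u ∉ K := by
    rintro _ ⟨x, ⟨hx0, hx⟩, rfl⟩ ⟨⟨_, w⟩, hw, rfl : _ = turn x.1⟩
    have := hret (turn x) w (hφ.dropMiddle_turn_eq_zero hx0)
      (by rw [hφ.middle_turn]; simpa using hray hx.2) hw
    rw [hφ.middle_turn, turn_complex] at this
    have hne := hφ.middle_ne_zero hx0
    have him := hw.2.2
    have hre := hw.2.1
    change 0 ≤ (φ ((turn x).1, w)).1.2.re at hre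
    change (φ ((turn x).1, w)).1.2.im = 0 at him
    rw [← this] at him hre
    exact hne (Complex.ext (by simpa using him) hx.2)
  have h2 : ∀ u ∈ K, turn (turn u) ∉ K := by
    rintro _ ⟨x, ⟨hx0, hx⟩, rfl⟩ ⟨⟨_, w⟩, hw, rfl : _ = turn (turn x.1)⟩
    have := hret (turn (turn x)) w
      (hφ.dropMiddle_turn_eq_zero (hφ.dropMiddle_turn_eq_zero hx0))
      (by rw [hφ.middle_turn, hφ.middle_turn]; simpa using hray hx.2) hw
    rw [hφ.middle_turn, hφ.middle_turn, turn_complex, turn_complex] at this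
    have hne := hφ.middle_ne_zero hx0
    have hre := hw.2.1
    change 0 ≤ (φ ((turn (turn x)).1, w)).1.2.re at hre
    rw [← this] at hre
    exact hne (Complex.ext (le_antisymm (by simpa using hre) hx.1) hx.2)
  obtain ⟨h, hh, hturn, hhK⟩ := exists_contDiff_equivariant_eq_one hK h1 h2
  refine ⟨fun u => ((2 * R : ℝ) : ℂ) * h u, contDiff_const.mul hh, fun u => ?_,
    fun u s hs h0 hax => ?_⟩
  · simp only [hturn, turn_complex]
    ring
  · obtain ⟨y, ⟨hy0, hys⟩, hyr, hyi⟩ := exists_rotate_mem_ray (α := U × ℂ) (T := turn)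
      (a := fun x => (φ x).1.2) (fun x => hφ.middle_turn x)
      (p := fun x => dropMiddle V ℂ (φ x) = 0 ∧ x.2 - ((2 * R : ℝ) : ℂ) * h x.1 ∈ diagonals)
      (fun x hx => ⟨hφ.dropMiddle_turn_eq_zero hx.1, by
        have := I_mul_mem_diagonals.2 hx.2
        rw [mul_sub] at this
        simpa [hturn, mul_left_comm] using this⟩)
      (x := (u, ((2 * R : ℝ) : ℂ) * h u + s)) ⟨h0, by simpa using hs⟩ hax
    have hyK : y.1 ∈ K := ⟨y, ⟨hy0, hyr, hyi⟩, rfl⟩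
    rw [hhK _ hyK, mul_one] at hys
    have hlt : ‖y.2‖ < R := (norm_snd_le y).trans_lt (hR _ (congrArg Prod.snd hy0))
    have hre := abs_lt.1 ((Complex.abs_re_le_norm y.2).trans_lt hlt)
    have him := abs_lt.1 ((Complex.abs_im_le_norm y.2).trans_lt hlt)
    have hsq : (y.2.re - 2 * R) ^ 2 = y.2.im ^ 2 := by simpa [diagonals] using hys
    rcases sq_eq_sq_iff_eq_or_eq_neg.1 hsq with h | h <;> linarith

/-- If zeros on crosses are unique in each fibre and their suspension coordinates are not on the
axes, then the suspension coordinate `ℂ` can be removed. -/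
lemma IsSeparating.exists_of_unique_zero_cross {φ : U × ℂ → (V × ℂ) × ℝ} (hφ : IsSeparating φ)
    {h : U → ℂ} (hh : Continuous h) (hturn : ∀ u, h (turn u) = turn (h u))
    (hax : ∀ u, ∀ s ∈ diagonals, dropMiddle V ℂ (φ (u, h u + s)) = 0 →
      (φ (u, h u + s)).1.2 ∉ axes)
    (huniq : ∀ u, ∀ s ∈ diagonals, ∀ s' ∈ diagonals, dropMiddle V ℂ (φ (u, h u + s)) = 0 →
      dropMiddle V ℂ (φ (u, h u + s')) = 0 → s = s') :
    ∃ ψ : U → V × ℝ, IsSeparating ψ := by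
  obtain ⟨R, hR0, hR⟩ := hφ.exists_bound
  let D : Set (U × ℂ) := {x | x.2 - h x.1 ∈ diagonals}
  have hD : IsClosed D := isClosed_diagonals.preimage (by fun_prop)
  have hDturn : ∀ x ∈ D, turn x ∈ D := fun x hx => by
    have := I_mul_mem_diagonals.2 hx
    rw [mul_sub] at this
    simpa [D, hturn] using this
  have hDax : ∀ x ∈ D, dropMiddle V ℂ (φ x) = 0 → (φ x).1.2 ∉ axes := by
    rintro ⟨u, w⟩ hx h0
    have := hax u _ hx
    simp only [add_sub_cancel] at this
    exact this h0
  have hDuniq : ∀ x ∈ D, ∀ w, (x.1, w) ∈ D → dropMiddle V ℂ (φ x) = 0 →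
      dropMiddle V ℂ (φ (x.1, w)) = 0 → (x.1, w) = x := by
    rintro ⟨u, w'⟩ hx w hw h0 h0'
    have := huniq u _ hx _ hw
    simp only [add_sub_cancel] at this
    rw [sub_left_injective (this h0 h0')]
  let S : Set ((V × ℂ) × ℝ) := {y | dropMiddle V ℂ y = 0 ∧ 0 ≤ y.1.2.re ∧ 0 ≤ y.1.2.im}
  have hS : IsClosed S :=
    (isClosed_eq (dropMiddle V ℂ).continuous continuous_const).inter
      ((isClosed_le continuous_const (g := fun y : (V × ℂ) × ℝ => y.1.2.re) (by fun_prop)).inter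
        (isClosed_le continuous_const (g := fun y : (V × ℂ) × ℝ => y.1.2.im) (by fun_prop)))
  let K := Prod.fst '' (φ ⁻¹' S ∩ D)
  have hK : IsCompact K :=
    ((hφ.isCompact_preimage hS fun y hy => congrArg Prod.snd hy.1).inter_right hD).image
      continuous_fst
  have h1 : ∀ u ∈ K, turn u ∉ K := by
    rintro _ ⟨x, ⟨⟨hx0, hx⟩, hxD⟩, rfl⟩ ⟨⟨_, w⟩, ⟨hw, hwD⟩, rfl : _ = turn x.1⟩
    have := hDuniq (turn x) (hDturn _ hxD) w hwD (hφ.dropMiddle_turn_eq_zero hx0) hw.1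
    have hw' : φ (turn x) ∈ S := this ▸ hw
    have hre := hw'.2.1
    rw [hφ.middle_turn, turn_complex] at hre
    exact hDax x hxD hx0 (Or.inr (le_antisymm (by simpa using hre) hx.2))
  have h2 : ∀ u ∈ K, turn (turn u) ∉ K := by
    rintro _ ⟨x, ⟨⟨hx0, hx⟩, hxD⟩, rfl⟩ ⟨⟨_, w⟩, ⟨hw, hwD⟩, rfl : _ = turn (turn x.1)⟩
    have := hDuniq (turn (turn x)) (hDturn _ (hDturn _ hxD)) w hwD
      (hφ.dropMiddle_turn_eq_zero (hφ.dropMiddle_turn_eq_zero hx0)) hw.1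
    have hw' : φ (turn (turn x)) ∈ S := this ▸ hw
    have hre := hw'.2.1
    rw [hφ.middle_turn, hφ.middle_turn, turn_complex, turn_complex] at hre
    exact hDax x hxD hx0 (Or.inl (le_antisymm (by simpa using hre) hx.1))
  obtain ⟨k, hk, hkturn, hkK⟩ := exists_contDiff_equivariant_eq_one hK h1 h2
  obtain ⟨M, hM⟩ := hK.exists_bound_of_continuousOn hh.continuousOn
  let ζ := diagonalVector true
  let H : U → ℂ := fun u => h u + ((R + M : ℝ) : ℂ) * (ζ * toAxes (k u))
  have hkc := continuous_toAxes.comp hk.continuous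
  have hHc : Continuous H := hh.add (continuous_const.mul (continuous_const.mul hkc))
  have hHturn : ∀ u, H (turn u) = turn (H u) := fun u => by
    simp only [H, hturn, hkturn, turn_complex, toAxes_I_mul]
    ring
  have hH0 : H 0 = 0 := by
    have := hHturn 0
    rw [map_zero, turn_complex] at this
    have hne : (1 - Complex.I) ≠ 0 := by
      intro h
      simpa using congrArg Complex.re h
    refine (mul_eq_zero.1 (?_ : (1 - Complex.I) * H 0 = 0)).resolve_left hne
    linear_combination this
  refine ⟨_, hφ.comp_graph hHc hHturn hH0 fun u hu => ?_⟩
  obtain ⟨y, ⟨hy0, hyH⟩, hyr, hyi⟩ := exists_rotate_mem_quadrant (α := U × ℂ) (T := turn)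
    (a := fun x => (φ x).1.2) (fun x => hφ.middle_turn x)
    (p := fun x => dropMiddle V ℂ (φ x) = 0 ∧ x.2 = H x.1)
    (fun x hx => ⟨hφ.dropMiddle_turn_eq_zero hx.1, by simp [hHturn, hx.2]⟩)
    (x := (u, H u)) ⟨hu, rfl⟩
  have hyD : y ∈ D := by
    change y.2 - h y.1 ∈ diagonals
    rw [hyH, add_sub_cancel_left, mul_left_comm]
    refine diagonalVector_mul_mem_diagonals ?_
    rcases toAxes_mem_axes (k y.1) with h | h
    · exact Or.inl (by simp [h])
    · exact Or.inr (by simp [h])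
  have hyK : y.1 ∈ K := ⟨y, ⟨⟨hy0, hyr, hyi⟩, hyD⟩, rfl⟩
  have hlt : ‖y.2‖ < R := (norm_snd_le y).trans_lt (hR _ (congrArg Prod.snd hy0))
  have hre := abs_lt.1 ((Complex.abs_re_le_norm y.2).trans_lt hlt)
  have hre' := abs_le.1 ((Complex.abs_re_le_norm _).trans (hM _ hyK))
  have : y.2.re = (h y.1).re + (R + M) := by
    simp [hyH, H, hkK _ hyK, ζ, diagonalVector]
  linarith

theorem PerturbationFamily.desuspend_complex [FiniteDimensional ℝ V]
    [FiniteDimensional ℝ P₀] [FiniteDimensional ℝ F₀]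
    (𝓛 : PerturbationFamily U V ℂ Q P₀ F₀)
    (hdim : finrank ℝ U < 2 * finrank ℝ V) {φ : U × ℂ → (V × ℂ) × ℝ} (hφ : IsSeparating φ) :
    ∃ ψ : U → V × ℝ, IsSeparating ψ := by
  obtain ⟨φ₀, hφ₀, hsmooth₀⟩ := hφ.exists_contDiff
  obtain ⟨φ₁, hφ₁, hsmooth₁, -, hfree₁, hpair₁⟩ := 𝓛.exists_generic hφ₀ hsmooth₀
    (ι := Bool × Bool) (P := U × ℂ × ℂ) (F := ((V × ℝ) × ℝ) × ((V × ℝ) × ℝ))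
    (fun _ => id) (fun _ => contDiff_id)
    (fun i => (dropPart V i.1).prodMap (dropPart V i.2))
    (fun i => (dropPart_surjective V i.1).prodMap (dropPart_surjective V i.2))
    (by simp only [finrank_prod, finrank_self, Complex.finrank_real_complex]; omega)
    isClosed_empty isClosed_empty (by simp) (by simp)
  obtain ⟨h, hh, hturn, hax⟩ := hφ₁.exists_cross fun u w w' hw hw' ha ha' => by
    by_contra hne
    obtain ⟨b, hb⟩ := exists_dropPart_eq_zero hw ha
    obtain ⟨b', hb'⟩ := exists_dropPart_eq_zero hw' ha'
    by_cases hu : u ∈ 𝓛.free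
    · exact hpair₁ (b, b') (u, w, w') hu hne hw hw' (Prod.ext hb hb')
    · exact hfree₁ u hu w hw
  obtain ⟨ψ, hψ, -, hψax, hfree, hpair⟩ := 𝓛.exists_generic hφ₁ hsmooth₁
    (ι := Bool × Bool) (P := U × ℝ × ℝ) (F := (V × ℝ) × (V × ℝ))
    (fun i p => (p.1, h p.1 + p.2.1 • diagonalVector i.1, h p.1 + p.2.2 • diagonalVector i.2))
    (fun i => by fun_prop)
    (fun _ => (dropMiddle V ℂ).prodMap (dropMiddle V ℂ))
    (fun _ => (dropMiddle_surjective V ℂ).prodMap (dropMiddle_surjective V ℂ))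
    (by simp only [finrank_prod, finrank_self]; omega)
    (C := {x | x.2 - h x.1 ∈ diagonals})
    (isClosed_diagonals.preimage (continuous_snd.sub (hh.continuous.comp continuous_fst)))
    (N := {y | dropMiddle V ℂ y = 0 ∧ y.1.2 ∈ axes})
    ((isClosed_eq (dropMiddle V ℂ).continuous continuous_const).inter
      (isClosed_axes.preimage (continuous_snd.comp continuous_fst)))
    (fun y hy => (congrArg Prod.snd hy.1).ge)
    (fun x hx hxN => by
      have := hax x.1 _ hx
      simp only [add_sub_cancel] at this
      exact this hxN.1 hxN.2)
  refine hψ.exists_of_unique_zero_cross hh.continuous hturn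
    (fun u s hs h0 ha => hψax (u, h u + s) (by simpa using hs) ⟨h0, ha⟩)
    fun u s hs s' hs' h0 h0' => ?_
  by_contra hne
  obtain ⟨b, t, rfl⟩ := exists_smul_diagonalVector hs
  obtain ⟨b', t', rfl⟩ := exists_smul_diagonalVector hs'
  by_cases hu : u ∈ 𝓛.free
  · exact hpair (b, b') (u, t, t') hu (by simpa using hne) h0 h0' (Prod.ext h0 h0')
  · exact hfree u hu _ h0

end ComplexStep

section EquivariantFamily

variable {X Y Y' P P' : Type*} [NormedAddCommGroup X] [NormedSpace ℝ X] [QuarterTurn X]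
  [NormedAddCommGroup Y] [NormedSpace ℝ Y] [QuarterTurn Y]
  [NormedAddCommGroup Y'] [NormedSpace ℝ Y'] [QuarterTurn Y']
  [NormedAddCommGroup P] [NormedSpace ℝ P] [FiniteDimensional ℝ P]
  [NormedAddCommGroup P'] [NormedSpace ℝ P'] [FiniteDimensional ℝ P']

variable (X Y P) in
/-- A family of equivariant maps `X → Y` depending linearly on a parameter in `P`. -/
structure EquivariantFamily where
  toFun : X → P →L[ℝ] Y
  contDiff : ContDiff ℝ 1 toFun
  map_turn : ∀ x c, toFun (turn x) c = turn (toFun x c)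

namespace EquivariantFamily

/-- The family of pairs of members of two families. -/
def prod (e : EquivariantFamily X Y P) (e' : EquivariantFamily X Y' P') :
    EquivariantFamily X (Y × Y') (P × P') where
  toFun x := (e.toFun x).prodMap (e'.toFun x)
  contDiff := contDiff_clm_apply_iff.2 fun _ =>
    (e.contDiff.clm_apply contDiff_const).prodMk (e'.contDiff.clm_apply contDiff_const)
  map_turn x c := Prod.ext (e.map_turn x c.1) (e'.map_turn x c.2)

/-- The family of tuples of members of a family. -/
def pi (e : EquivariantFamily X Y P) (ι : Type*) [Fintype ι] :
    EquivariantFamily X (ι → Y) (ι → P) where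
  toFun x := ContinuousLinearMap.piMap fun _ => e.toFun x
  contDiff := contDiff_clm_apply_iff.2 fun _ => contDiff_pi.2 fun _ =>
    e.contDiff.clm_apply contDiff_const
  map_turn x c := funext fun i => e.map_turn x (c i)

lemma prod_surjective {e : EquivariantFamily X Y P} {e' : EquivariantFamily X Y' P'} {x : X}
    (h : Function.Surjective (e.toFun x)) (h' : Function.Surjective (e'.toFun x)) :
    Function.Surjective ((e.prod e').toFun x) :=
  h.prodMap h'

lemma pi_surjective {e : EquivariantFamily X Y P} {ι : Type*} [Fintype ι] {x : X}
    (h : Function.Surjective (e.toFun x)) : Function.Surjective ((e.pi ι).toFun x) :=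
  Function.Surjective.piMap fun _ => h

/-- The family of linear functionals of an odd map. -/
noncomputable def ofOdd {Z : Type*} [NormedAddCommGroup Z] [NormedSpace ℝ Z] [FiniteDimensional ℝ Z]
    (y : X → Z) (hy : ContDiff ℝ 1 y) (hturn : ∀ x, y (turn x) = -y x) :
    EquivariantFamily X ℝ (Z →L[ℝ] ℝ) where
  toFun x := ContinuousLinearMap.apply ℝ ℝ (y x)
  contDiff := contDiff_clm_apply_iff.2 fun c => c.contDiff.comp hy
  map_turn x c := by simp [hturn]

lemma ofOdd_surjective {Z : Type*} [NormedAddCommGroup Z] [NormedSpace ℝ Z]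
    [FiniteDimensional ℝ Z] {y : X → Z} {hy : ContDiff ℝ 1 y}
    {hturn : ∀ x, y (turn x) = -y x} {x : X} (hx : y x ≠ 0) :
    Function.Surjective ((ofOdd y hy hturn).toFun x) := by
  intro s
  obtain ⟨f, hf⟩ := SeparatingDual.exists_eq_one (R := ℝ) hx
  exact ⟨s • f, by simp [ofOdd, hf]⟩

/-- The family of complex linear functionals of an equivariant map to a complex vector space. -/
noncomputable def ofComplex {Z : Type*} [NormedAddCommGroup Z] [NormedSpace ℂ Z] [NormedSpace ℝ Z]
    [FiniteDimensional ℝ Z] (z : X → Z) (hz : ContDiff ℝ 1 z)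
    (hturn : ∀ x, z (turn x) = Complex.I • z x) : EquivariantFamily X ℂ (Z →L[ℝ] ℂ) where
  toFun x := ContinuousLinearMap.apply ℝ ℂ (z x) - (turn (X := ℂ)).toContinuousLinearMap.comp
    (ContinuousLinearMap.apply ℝ ℂ (z (turn x)))
  contDiff := contDiff_clm_apply_iff.2 fun c => (c.contDiff.comp hz).sub
    ((turn (X := ℂ)).contDiff.comp (c.contDiff.comp (hz.comp (turn (X := X)).contDiff)))
  map_turn x c := by
    have : z (turn (turn x)) = -z x := by
      rw [hturn, hturn, smul_smul, Complex.I_mul_I, neg_one_smul]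
    change c (z (turn x)) - Complex.I * c (z (turn (turn x))) =
      Complex.I * (c (z x) - Complex.I * c (z (turn x)))
    rw [this, map_neg]
    linear_combination (c (z (turn x))) * Complex.I_sq

lemma ofComplex_surjective {Z : Type*} [NormedAddCommGroup Z] [NormedSpace ℂ Z] [NormedSpace ℝ Z]
    [IsScalarTower ℝ ℂ Z] [FiniteDimensional ℝ Z] {z : X → Z} {hz : ContDiff ℝ 1 z}
    {hturn : ∀ x, z (turn x) = Complex.I • z x} {x : X} (hx : z x ≠ 0) :
    Function.Surjective ((ofComplex z hz hturn).toFun x) := by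
  intro s
  obtain ⟨f, hf⟩ := SeparatingDual.exists_eq_one (R := ℂ) hx
  refine ⟨((s / 2) • f).restrictScalars ℝ, ?_⟩
  change s / 2 * f (z x) - Complex.I * (s / 2 * f (z (turn x))) = s
  rw [hturn, _root_.map_smul, hf, smul_eq_mul]
  linear_combination -(s / 2) * Complex.I_sq

end EquivariantFamily

variable {U V W H F₀ P₀ : Type*}
  [NormedAddCommGroup U] [NormedSpace ℝ U] [QuarterTurn U]
  [NormedAddCommGroup V] [NormedSpace ℝ V] [QuarterTurn V]
  [NormedAddCommGroup W] [NormedSpace ℝ W] [QuarterTurn W]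
  [NormedAddCommGroup H] [NormedSpace ℝ H] [FiniteDimensional ℝ H]
  [NormedAddCommGroup P₀] [NormedSpace ℝ P₀]
  [NormedAddCommGroup F₀] [NormedSpace ℝ F₀]

/-- Making the parameters of an equivariant family depend on an invariant map that separates the
points of fibres produces enough perturbations for general position of pairs. -/
noncomputable def EquivariantFamily.perturbationFamily (e : EquivariantFamily (U × W) (V × W) P)
    (θ : U × W → H) (hθ : ContDiff ℝ 1 θ) (hturn : ∀ x, θ (turn x) = θ x) (free : Set U)
    (hsurj : ∀ u ∈ free, ∀ w, Function.Surjective (e.toFun (u, w)))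
    (hsep : ∀ u ∈ free, ∀ w w', θ (u, w) = θ (u, w') → w = w')
    (incl : P₀ →L[ℝ] U × W) (proj : V × ℝ →L[ℝ] F₀)
    (exists_incl : ∀ u ∉ free, ∀ w, ∃ p, incl p = (u, w))
    (hproj : ∀ p ≠ 0, Function.Surjective fun c : P × ℝ =>
      proj (dropMiddle V W (e.toFun (incl p) c.1, c.2)))
    (finrank_lt : finrank ℝ P₀ < finrank ℝ F₀) :
    PerturbationFamily U V W ((P × ℝ) × (H →L[ℝ] P × ℝ)) P₀ F₀ where
  toFun x := ((e.toFun x).prodMap (ContinuousLinearMap.id ℝ ℝ)).comp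
    (ContinuousLinearMap.fst ℝ (P × ℝ) (H →L[ℝ] P × ℝ) +
      (ContinuousLinearMap.apply ℝ (P × ℝ) (θ x)).comp (ContinuousLinearMap.snd ℝ _ _))
  contDiff := by
    refine ContDiff.clm_comp (contDiff_clm_apply_iff.2 fun _ =>
      (e.contDiff.clm_apply contDiff_const).prodMk contDiff_const)
      (contDiff_clm_apply_iff.2 fun c => contDiff_const.add (c.2.contDiff.comp hθ))
  map_turn x c := by
    simp only [hturn]
    exact Prod.ext (e.map_turn _ _) rfl
  free := free
  pair_surjective := by
    rintro u hu w w' hne ⟨y, y'⟩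
    have hsub : θ (u, w') - θ (u, w) ≠ 0 := fun h => hne (hsep u hu _ _ (sub_eq_zero.1 h).symm)
    obtain ⟨f, hf⟩ := SeparatingDual.exists_eq_one (R := ℝ) hsub
    obtain ⟨c, hc⟩ := hsurj u hu w y.1
    obtain ⟨c', hc'⟩ := hsurj u hu w' y'.1
    let T : H →L[ℝ] P × ℝ := f.smulRight ((c', y'.2) - (c, y.2))
    refine ⟨((c, y.2) - T (θ (u, w)), T), ?_⟩
    have h1 : (c, y.2) - T (θ (u, w)) + T (θ (u, w)) = (c, y.2) := sub_add_cancel _ _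
    have h2 : (c, y.2) - T (θ (u, w)) + T (θ (u, w')) = (c', y'.2) := by
      rw [sub_add_eq_add_sub, add_sub_assoc, ← map_sub]
      simp [T, hf]
    refine Prod.ext ?_ ?_
    · change (e.toFun (u, w)).prodMap (ContinuousLinearMap.id ℝ ℝ)
        ((c, y.2) - T (θ (u, w)) + T (θ (u, w))) = y
      rw [h1]
      exact Prod.ext hc rfl
    · change (e.toFun (u, w')).prodMap (ContinuousLinearMap.id ℝ ℝ)
        ((c, y.2) - T (θ (u, w)) + T (θ (u, w'))) = y'
      rw [h2]
      exact Prod.ext hc' rfl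
  incl := incl
  proj := proj
  exists_incl := exists_incl
  proj_surjective p hp y := by
    obtain ⟨c, hc⟩ := hproj p hp y
    exact ⟨(c, 0), by simpa using hc⟩
  finrank_lt := finrank_lt
  finiteDimensional := inferInstance
  nontrivial := inferInstance

end EquivariantFamily

section Concrete

open EquivariantFamily

lemma eq_zero_of_mul_self_eq_zero {R : Type*} [MonoidWithZero R] [IsReduced R] {x : R}
    (h : x * x = 0) : x = 0 :=
  pow_eq_zero_iff two_ne_zero |>.1 ((sq x).trans h)

theorem desuspend_real {a b c d : ℕ} (hbd : b < d) (hdim : 2 * a + b < 2 * (2 * c + d))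
    {φ : ((Fin a → ℂ) × (Fin b → ℝ)) × ℝ → (((Fin c → ℂ) × (Fin d → ℝ)) × ℝ) × ℝ}
    (hφ : IsSeparating φ) :
    ∃ ψ : (Fin a → ℂ) × (Fin b → ℝ) → ((Fin c → ℂ) × (Fin d → ℝ)) × ℝ, IsSeparating ψ := by
  let X := ((Fin a → ℂ) × (Fin b → ℝ)) × ℝ
  let κ := ofComplex (fun x : X => x.1.1) (by fun_prop) (fun _ => rfl)
  let y : X → (Fin a → ℂ) × ((Fin b → ℝ) × ℝ) := fun x => (x.1.1 * x.1.1, (x.1.2, x.2))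
  let κ' := ofOdd y (by fun_prop) (fun x => by
    refine Prod.ext ?_ rfl
    change (Complex.I • x.1.1) * (Complex.I • x.1.1) = -(x.1.1 * x.1.1)
    rw [smul_mul_smul_comm, Complex.I_mul_I, neg_one_smul])
  let incl : (Fin b → ℝ) × ℝ →L[ℝ] X :=
    ((0 : (Fin b → ℝ) × ℝ →L[ℝ] Fin a → ℂ).prod (ContinuousLinearMap.fst ℝ _ _)).prod
      (ContinuousLinearMap.snd ℝ _ _)
  let proj : ((Fin c → ℂ) × (Fin d → ℝ)) × ℝ →L[ℝ] (Fin d → ℝ) × ℝ :=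
    (ContinuousLinearMap.snd ℝ _ _).prodMap (ContinuousLinearMap.id ℝ ℝ)
  have hκ' : ∀ x, y x ≠ 0 → Function.Surjective (κ'.toFun x) := fun x hx => ofOdd_surjective hx
  refine (((((κ.pi (Fin c)).prod (κ'.pi (Fin d))).prod κ').perturbationFamily
    (fun x => x.2 • (x.1.1 * x.1.1)) (by fun_prop) (fun x => ?_) {u | u.1 ≠ 0} (fun u hu w => ?_)
    (fun u hu w w' h => ?_) incl proj (fun u hu w => ?_) (fun p hp => ?_) ?_)).desuspend_real ?_ hφ
  · change (-x.2) • ((Complex.I • x.1.1) * (Complex.I • x.1.1)) = _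
    rw [smul_mul_smul_comm, Complex.I_mul_I, neg_one_smul, neg_smul_neg]
  · have hy := hκ' (u, w) fun h => hu (eq_zero_of_mul_self_eq_zero (congrArg Prod.fst h))
    exact prod_surjective (prod_surjective (pi_surjective (ofComplex_surjective hu))
      (pi_surjective hy)) hy
  · exact smul_left_injective ℝ (fun h0 => hu (eq_zero_of_mul_self_eq_zero h0)) h
  · refine ⟨(u.2, w), Prod.ext (Prod.ext ?_ rfl) rfl⟩
    exact (not_not.1 hu).symm
  · rintro ⟨s, t⟩
    obtain ⟨c', hc'⟩ := pi_surjective (ι := Fin d)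
      (hκ' (incl p) fun h => hp (congrArg Prod.snd h)) s
    exact ⟨(((0, c'), 0), t), Prod.ext hc' rfl⟩
  · simpa using hbd
  · simp only [finrank_prod, finrank_pi_fintype, finrank_self, Complex.finrank_real_complex]
    simp
    omega

theorem desuspend_complex {a c d : ℕ} (hd : 2 ≤ d) (hdim : a < 2 * c + d)
    {φ : (Fin a → ℂ) × ℂ → (((Fin c → ℂ) × (Fin d → ℝ)) × ℂ) × ℝ} (hφ : IsSeparating φ) :
    ∃ ψ : (Fin a → ℂ) → ((Fin c → ℂ) × (Fin d → ℝ)) × ℝ, IsSeparating ψ := by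
  let X := (Fin a → ℂ) × ℂ
  have hturn : ∀ x : X, turn x = Complex.I • x := fun _ => rfl
  let κ := ofComplex (fun x : X => x) contDiff_id hturn
  let κ' := ofOdd (fun x : X => x * x) (by fun_prop) (fun x => by
    rw [hturn, smul_mul_smul_comm, Complex.I_mul_I, neg_one_smul])
  let κ'' := ((κ.pi (Fin c)).prod (κ'.pi (Fin d))).prod κ
  have hκ : ∀ x ≠ 0, Function.Surjective (κ''.toFun x) := fun x hx =>
    prod_surjective (prod_surjective (pi_surjective (ofComplex_surjective hx))
      (pi_surjective (ofOdd_surjective fun h => hx (eq_zero_of_mul_self_eq_zero h))))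
        (ofComplex_surjective hx)
  refine (κ''.perturbationFamily (fun x j => starRingEnd ℂ (x.1 j) * x.2) ?_ (fun x => ?_)
    {u | u ≠ 0} (fun u hu w => hκ _ fun h => hu (congrArg Prod.fst h)) (fun u hu w w' h => ?_)
    (ContinuousLinearMap.inr ℝ (Fin a → ℂ) ℂ) (ContinuousLinearMap.id ℝ _) (fun u hu w => ?_)
    (fun p hp => ?_) ?_).desuspend_complex ?_ hφ
  · refine contDiff_pi.2 fun j => ContDiff.mul ?_ contDiff_snd
    have h : ContDiff ℝ 1 fun x : (Fin a → ℂ) × ℂ => x.1 j := by fun_prop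
    exact Complex.conjCLE.contDiff.comp h
  · ext j
    change starRingEnd ℂ (Complex.I * x.1 j) * (Complex.I * x.2) = _
    rw [map_mul, Complex.conj_I]
    linear_combination -(starRingEnd ℂ (x.1 j) * x.2) * Complex.I_sq
  · obtain ⟨j, hj⟩ := Function.ne_iff.1 hu
    exact mul_left_cancel₀ ((map_ne_zero _).2 hj) (congrFun h j)
  · exact ⟨w, Prod.ext (not_not.1 hu).symm rfl⟩
  · rintro ⟨v, t⟩
    obtain ⟨c', hc'⟩ := hκ (ContinuousLinearMap.inr ℝ (Fin a → ℂ) ℂ p)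
      (fun h => hp (congrArg Prod.snd h)) (v, 0)
    have hv := congrArg Prod.fst hc'
    exact ⟨(c', t), Prod.ext hv rfl⟩
  · simp only [finrank_prod, finrank_pi_fintype, finrank_self, Complex.finrank_real_complex]
    simp
    omega
  · simp only [finrank_prod, finrank_pi_fintype, finrank_self, Complex.finrank_real_complex]
    simp
    omega

end Concrete

section Transport

variable {X X' E E' : Type*} [NormedAddCommGroup X] [NormedSpace ℝ X] [QuarterTurn X]
  [NormedAddCommGroup X'] [NormedSpace ℝ X'] [QuarterTurn X'] [FiniteDimensional ℝ X']
  [NormedAddCommGroup E] [NormedSpace ℝ E] [QuarterTurn E] [FiniteDimensional ℝ E]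
  [NormedAddCommGroup E'] [NormedSpace ℝ E'] [QuarterTurn E']

lemma IsSeparating.comp_linear {φ : X → E × ℝ} (hφ : IsSeparating φ)
    (e : X' →ₗ[ℝ] X) (he : Function.Injective e) (heturn : ∀ x, e (turn x) = turn (e x))
    (s : E →ₗ[ℝ] E') (hs : Function.Injective s) (hsturn : ∀ v, s (turn v) = turn (s v)) :
    IsSeparating fun x => (s (φ (e x)).1, (φ (e x)).2) where
  continuous := by
    have hc := hφ.continuous.comp e.continuous_of_finiteDimensional
    exact (s.continuous_of_finiteDimensional.comp (continuous_fst.comp hc)).prodMk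
      (continuous_snd.comp hc)
  map_turn x := by simp [heturn, hφ.map_turn, hsturn]
  ne_zero x h := by
    rw [Prod.mk_eq_zero] at h
    exact hφ.ne_zero (e x) (Prod.ext (hs (h.1.trans s.map_zero.symm)) h.2)
  pos_zero := by simpa using hφ.pos_zero
  neg_far := by
    obtain ⟨R, hR⟩ := hφ.neg_far
    obtain ⟨K, hK, hanti⟩ := e.exists_antilipschitzWith (LinearMap.ker_eq_bot.2 he)
    refine ⟨K * R, fun x hx => hR _ ?_⟩
    have h1 : ‖x‖ ≤ K * ‖e x‖ := by simpa using hanti.le_mul_norm (map_zero e) x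
    exact le_of_mul_le_mul_left (hx.trans h1) (by exact_mod_cast hK)

end Transport

section Induction

theorem desuspend_reals {a c d : ℕ} {k : ℕ} (hk : 1 ≤ k) (hdim : a + 1 ≤ c + k)
    (b : ℕ) (hd : d = b + k) {φ : (Fin a → ℂ) × (Fin b → ℝ) → ((Fin c → ℂ) × (Fin d → ℝ)) × ℝ}
    (hφ : IsSeparating φ) :
    ∃ ψ : (Fin a → ℂ) → ((Fin c → ℂ) × (Fin k → ℝ)) × ℝ, IsSeparating ψ := by
  induction b generalizing d with
  | zero =>
    obtain rfl : d = k := by omega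
    refine ⟨_, hφ.comp_linear (LinearMap.inl ℝ _ _) LinearMap.inl_injective (fun x => ?_)
      LinearMap.id Function.injective_id fun _ => rfl⟩
    exact Prod.ext rfl (map_zero (turn (X := Fin 0 → ℝ))).symm
  | succ b ih =>
    obtain ⟨d, rfl⟩ : ∃ d', d = d' + 1 := ⟨b + k, by omega⟩
    let e : ((Fin a → ℂ) × (Fin b → ℝ)) × ℝ →ₗ[ℝ] (Fin a → ℂ) × (Fin (b + 1) → ℝ) :=
      { toFun := fun x => (x.1.1, Fin.cons x.2 x.1.2)
        map_add' := fun x y => Prod.ext rfl (funext (Fin.cases rfl fun _ => rfl))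
        map_smul' := fun r x => Prod.ext rfl (funext (Fin.cases rfl fun _ => rfl)) }
    have he : Function.Injective e := fun x y h => by
      obtain ⟨h1, h2⟩ := Prod.ext_iff.1 h
      exact Prod.ext (Prod.ext h1 (funext fun i => congrFun h2 i.succ)) (congrFun h2 0)
    let s : (Fin c → ℂ) × (Fin (d + 1) → ℝ) →ₗ[ℝ] ((Fin c → ℂ) × (Fin d → ℝ)) × ℝ :=
      { toFun := fun x => ((x.1, Fin.tail x.2), x.2 0)
        map_add' := fun _ _ => rfl
        map_smul' := fun _ _ => rfl }
    have hs : Function.Injective s := fun x y h => by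
      obtain ⟨h1, h2⟩ := Prod.ext_iff.1 h
      obtain ⟨h3, h4⟩ := Prod.ext_iff.1 h1
      exact Prod.ext h3 (funext (Fin.cases h2 (congrFun h4)))
    obtain ⟨ψ, hψ⟩ := desuspend_real (by omega) (by omega) (hφ.comp_linear e he
      (fun x => Prod.ext rfl (funext (Fin.cases rfl fun _ => rfl))) s hs fun _ => rfl)
    exact ih (by omega) hψ

theorem desuspend_complexes {a c d : ℕ} (hd : 2 ≤ d) (k : ℕ) (hdim : k + 1 ≤ d) (ha : a = k + c)
    {φ : (Fin a → ℂ) → ((Fin c → ℂ) × (Fin d → ℝ)) × ℝ} (hφ : IsSeparating φ) :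
    ∃ ψ : (Fin k → ℂ) → (Fin d → ℝ) × ℝ, IsSeparating ψ := by
  induction c generalizing a with
  | zero =>
    obtain rfl : a = k := by omega
    exact ⟨_, hφ.comp_linear LinearMap.id Function.injective_id (fun _ => rfl)
      (LinearMap.snd ℝ _ _) (fun x y h => Prod.ext (Subsingleton.elim _ _) h) fun _ => rfl⟩
  | succ c ih =>
    obtain ⟨a, rfl⟩ : ∃ a', a = a' + 1 := ⟨k + c, by omega⟩
    let e : (Fin a → ℂ) × ℂ →ₗ[ℝ] Fin (a + 1) → ℂ :=
      { toFun := fun x => Fin.cons x.2 x.1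
        map_add' := fun x y => funext (Fin.cases rfl fun _ => rfl)
        map_smul' := fun r x => funext (Fin.cases rfl fun _ => rfl) }
    have he : Function.Injective e := fun x y h =>
      Prod.ext (funext fun i => congrFun h i.succ) (congrFun h 0)
    let s : (Fin (c + 1) → ℂ) × (Fin d → ℝ) →ₗ[ℝ] ((Fin c → ℂ) × (Fin d → ℝ)) × ℂ :=
      { toFun := fun x => ((Fin.tail x.1, x.2), x.1 0)
        map_add' := fun _ _ => rfl
        map_smul' := fun _ _ => rfl }
    have hs : Function.Injective s := fun x y h => by
      obtain ⟨h1, h2⟩ := Prod.ext_iff.1 h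
      obtain ⟨h3, h4⟩ := Prod.ext_iff.1 h1
      exact Prod.ext (funext (Fin.cases h2 (congrFun h3))) h4
    obtain ⟨ψ, hψ⟩ := desuspend_complex hd (by omega) (hφ.comp_linear e he
      (fun x => funext (Fin.cases rfl fun _ => rfl)) s hs fun _ => rfl)
    exact ih (by omega) hψ

end Induction

section Compactification

open Filter

lemma exists_forall_norm_ge_of_mem_nhds_infty {X : Type*} [NormedAddCommGroup X] [ProperSpace X]
    {s : Set (OnePoint X)}
    (hs : s ∈ 𝓝 (OnePoint.infty : OnePoint X)) :
    ∃ R : ℝ, ∀ x : X, R ≤ ‖x‖ → (x : OnePoint X) ∈ s := by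
  rw [OnePoint.nhds_infty_eq, mem_sup] at hs
  have h := hs.1
  rw [mem_map, coclosedCompact_eq_cocompact, ← Metric.cobounded_eq_cocompact,
    (hasBasis_cobounded_norm (E := X)).mem_iff] at h
  obtain ⟨R, -, hR⟩ := h
  exact ⟨R, fun x hx => hR hx⟩

variable {X E : Type*} [NormedAddCommGroup X] [NormedSpace ℝ X]
  [NormedAddCommGroup E] [NormedSpace ℝ E]

/-- An embedding of the one-point compactification of `E` in `E × ℝ` avoiding the origin. -/
noncomputable def toHomogeneous : OnePoint E → E × ℝ
  | OnePoint.infty => (0, -1)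
  | OnePoint.some y => (((1 + ‖y‖)⁻¹ ^ 2) • y, 2 * (1 + ‖y‖)⁻¹ - 1)

lemma toHomogeneous_infty : toHomogeneous (OnePoint.infty : OnePoint E) = (0, -1) := rfl

lemma toHomogeneous_coe (y : E) : toHomogeneous (y : OnePoint E) =
    (((1 + ‖y‖)⁻¹ ^ 2) • y, 2 * (1 + ‖y‖)⁻¹ - 1) := rfl

lemma continuous_toHomogeneous [ProperSpace E] :
    Continuous (toHomogeneous : OnePoint E → E × ℝ) := by
  have hpos : ∀ y : E, 0 < 1 + ‖y‖ := fun y => by positivity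
  have hc : Continuous fun y : E => (1 + ‖y‖)⁻¹ :=
    (continuous_const.add continuous_norm).inv₀ fun y => (hpos y).ne'
  rw [OnePoint.continuous_iff, coclosedCompact_eq_cocompact]
  have hq : Tendsto (fun y : E => (1 + ‖y‖)⁻¹) (cocompact E) (𝓝 0) :=
    (tendsto_atTop_add_const_left _ 1 tendsto_norm_cocompact_atTop).inv_tendsto_atTop
  constructor
  · simp only [toHomogeneous_coe, toHomogeneous_infty]
    refine Tendsto.prodMk_nhds (squeeze_zero_norm (fun y => ?_) hq) ?_
    · rw [norm_smul, norm_pow, Real.norm_of_nonneg (inv_nonneg.2 (hpos y).le), sq, mul_assoc]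
      refine mul_le_of_le_one_right (inv_nonneg.2 (hpos y).le) ?_
      rw [inv_mul_le_one₀ (hpos y)]
      linarith
    · simpa using (hq.const_mul 2).sub_const 1
  · simp only [toHomogeneous_coe]
    fun_prop

open Classical in
/-- A continuous retraction of `toHomogeneous` on the complement of the origin, up to homotopy. -/
noncomputable def ofHomogeneous (y : E × ℝ) : OnePoint E :=
  if ‖y.1‖ ^ 2 + max y.2 0 = 0 then OnePoint.infty
  else (((‖y.1‖ ^ 2 + max y.2 0)⁻¹ • y.1 : E) : OnePoint E)

lemma ofHomogeneous_of_neg {b : ℝ} (hb : b < 0) :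
    ofHomogeneous ((0 : E), b) = OnePoint.infty := by
  simp [ofHomogeneous, max_eq_right hb.le]

lemma ofHomogeneous_of_pos {b : ℝ} (hb : 0 < b) :
    ofHomogeneous ((0 : E), b) = OnePoint.some 0 := by
  simp [ofHomogeneous, max_eq_left hb.le, hb.ne']

lemma continuousAt_ofHomogeneous [ProperSpace E] {y : E × ℝ} (hy : y ≠ 0) :
    ContinuousAt ofHomogeneous y := by
  have hD : Continuous fun y : E × ℝ => ‖y.1‖ ^ 2 + max y.2 0 := by fun_prop
  by_cases hy0 : ‖y.1‖ ^ 2 + max y.2 0 = 0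
  · have h2 : max y.2 0 = 0 := by nlinarith [le_max_right y.2 0, sq_nonneg ‖y.1‖]
    have h1 : y.1 = 0 := by simpa [h2] using hy0
    have hneg : y.2 < 0 := lt_of_le_of_ne (max_eq_right_iff.1 h2) fun h => hy (Prod.ext h1 h)
    intro s hs
    rw [show y = ((0 : E), y.2) from Prod.ext h1 rfl, ofHomogeneous_of_neg hneg] at hs
    obtain ⟨R, hR⟩ := exists_forall_norm_ge_of_mem_nhds_infty hs
    have hcont : Continuous fun y : E × ℝ => |R| * ‖y.1‖ := by fun_prop
    rw [mem_map]
    filter_upwards [(isOpen_Iio.preimage continuous_snd).mem_nhds hneg,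
      (isOpen_Iio.preimage hcont).mem_nhds (by simp [h1] : |R| * ‖y.1‖ < 1)] with z hz hz'
    have hz2 : max z.2 0 = 0 := max_eq_right (le_of_lt hz)
    rcases eq_or_ne z.1 0 with h | h
    · rw [Set.mem_preimage, show z = ((0 : E), z.2) from Prod.ext h rfl, ofHomogeneous_of_neg hz]
      exact mem_of_mem_nhds hs
    · have hpos : 0 < ‖z.1‖ := norm_pos_iff.2 h
      rw [Set.mem_preimage, ofHomogeneous, if_neg (by simp [hz2, h]), hz2, add_zero]
      refine hR _ ((le_abs_self R).trans ?_)
      rw [norm_smul, norm_inv, norm_pow, norm_norm, sq, mul_inv, mul_assoc,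
        inv_mul_cancel₀ hpos.ne', mul_one, ← one_div, le_div_iff₀ hpos]
      exact le_of_lt hz'
  · have hev : ∀ᶠ z in 𝓝 y, ofHomogeneous z =
        (((‖z.1‖ ^ 2 + max z.2 0)⁻¹ • z.1 : E) : OnePoint E) := by
      filter_upwards [hD.continuousAt.eventually_ne hy0] with z hz
      rw [ofHomogeneous, if_neg hz]
    refine ContinuousAt.congr ?_ (hev.mono fun _ h => h.symm)
    exact OnePoint.continuous_coe.continuousAt.comp
      ((hD.continuousAt.inv₀ hy0).smul continuousAt_fst)

variable [QuarterTurn X] [QuarterTurn E]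

lemma isSeparating_toHomogeneous_comp [ProperSpace X] [ProperSpace E]
    {f : OnePoint X → OnePoint E} (hf : Continuous f)
    (hinf : f OnePoint.infty = OnePoint.infty) (h0 : f (OnePoint.some 0) = OnePoint.some 0)
    (hturn : ∀ x : X, f (turn x : X) = OnePoint.map turn (f x)) :
    IsSeparating fun x : X => toHomogeneous (f x) where
  continuous := continuous_toHomogeneous.comp (hf.comp OnePoint.continuous_coe)
  map_turn x := by
    rw [hturn]
    induction f x using OnePoint.rec with
    | infty => simp [toHomogeneous_infty]
    | coe y => simp [toHomogeneous_coe]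
  ne_zero x h := by
    generalize f x = z at h
    induction z using OnePoint.rec with
    | infty => simp [toHomogeneous_infty] at h
    | coe y =>
      have hy : (1 + ‖y‖) ≠ 0 := by positivity
      rw [toHomogeneous_coe, Prod.mk_eq_zero] at h
      obtain rfl : y = 0 := by simpa [hy] using h.1
      norm_num at h
  pos_zero := by
    rw [h0, toHomogeneous_coe]
    norm_num
  neg_far := by
    have hc : Continuous fun x => (toHomogeneous (f x)).2 :=
      continuous_snd.comp (continuous_toHomogeneous.comp hf)
    refine exists_forall_norm_ge_of_mem_nhds_infty
      ((isOpen_Iio (a := (0 : ℝ))).preimage hc |>.mem_nhds ?_)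
    simp [hinf, toHomogeneous_infty]

lemma ofHomogeneous_targetTurn (y : E × ℝ) :
    ofHomogeneous (targetTurn E y) = OnePoint.map turn (ofHomogeneous y) := by
  simp only [ofHomogeneous, targetTurn_apply, LinearIsometry.norm_map]
  split_ifs
  · rfl
  · simp

lemma IsSeparating.exists_onePoint_map [ProperSpace X] [ProperSpace E] {φ : X → E × ℝ}
    (hφ : IsSeparating φ) (hfix : ∀ v : E, turn v = v → v = 0) :
    ∃ g : OnePoint X → OnePoint E, Continuous g ∧ g OnePoint.infty = OnePoint.infty ∧
      g (OnePoint.some 0) = OnePoint.some 0 ∧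
      ∀ x : X, g (turn x : X) = OnePoint.map turn (g x) := by
  obtain ⟨R, hR⟩ := hφ.neg_far
  let χ : X → ℝ := fun x => max 0 (min 1 (R + 1 - ‖x‖))
  let ψ : X → E × ℝ := fun x => (χ x • (φ x).1, (φ x).2)
  have hc := hφ.continuous
  have hψ : Continuous ψ := by fun_prop
  have hψ0 : ∀ x, ψ x ≠ 0 := fun x h => by
    obtain ⟨h1, h2⟩ := Prod.ext_iff.1 h
    have hx : ‖x‖ < R := by
      by_contra! hx
      exact (hR x hx).ne h2
    have hχ : χ x = 1 := by
      simp only [χ]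
      rw [min_eq_left (by linarith), max_eq_right zero_le_one]
    refine hφ.ne_zero x (Prod.ext ?_ h2)
    simpa [ψ, hχ] using h1
  have hfar : ∀ x, R + 1 ≤ ‖x‖ → ofHomogeneous (ψ x) = OnePoint.infty := fun x hx => by
    have hχ : χ x = 0 := max_eq_left ((min_le_right _ _).trans (by linarith))
    rw [show ψ x = (0, (φ x).2) by simp [ψ, hχ]]
    exact ofHomogeneous_of_neg (hR x (by linarith))
  refine ⟨fun x => x.elim OnePoint.infty fun x => ofHomogeneous (ψ x), ?_, rfl, ?_, fun x => ?_⟩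
  · rw [OnePoint.continuous_iff]
    constructor
    · refine tendsto_const_nhds.congr' ?_
      rw [coclosedCompact_eq_cocompact, ← Metric.cobounded_eq_cocompact]
      filter_upwards [(hasBasis_cobounded_norm (E := X)).mem_of_mem (i := R + 1) trivial] with x hx
      exact (hfar x hx).symm
    · exact continuous_iff_continuousAt.2 fun x =>
        (continuousAt_ofHomogeneous (hψ0 x)).comp hψ.continuousAt
  · have ha : (φ 0).1 = 0 := hfix _ (by simpa using (congrArg Prod.fst (hφ.map_turn 0)).symm)
    change ofHomogeneous (ψ 0) = _
    rw [show ψ 0 = (0, (φ 0).2) by simp [ψ, ha]]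
    exact ofHomogeneous_of_pos hφ.pos_zero
  · change ofHomogeneous (ψ (turn x)) = OnePoint.map turn (ofHomogeneous (ψ x))
    rw [← ofHomogeneous_targetTurn]
    simp [ψ, χ, hφ.map_turn]

end Compactification

noncomputable instance (n : ℕ) : QuarterTurn (EuclideanSpace ℂ (Fin n)) where
  turn :=
    { toFun := fun v => Complex.I • v
      map_add' := smul_add _
      map_smul' := fun r v => smul_comm _ _ _
      norm_map' := fun v => by
        change ‖Complex.I • v‖ = ‖v‖
        simp [norm_smul] }
  turn_four v := by
    change Complex.I • Complex.I • Complex.I • Complex.I • v = v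
    simp [smul_smul]

noncomputable instance (n : ℕ) : QuarterTurn (EuclideanSpace ℝ (Fin n)) where
  turn := (LinearIsometryEquiv.neg ℝ).toLinearIsometry
  turn_four := by simp

lemma eq_zero_of_turn_eq_self {n : ℕ} {v : EuclideanSpace ℝ (Fin n)} (hv : turn v = v) :
    v = 0 := by
  ext i
  have h : -v i = v i := congrArg (fun w : EuclideanSpace ℝ (Fin n) => w i) hv
  simpa using by linarith

section Coordinates

variable (a b : ℕ)

/-- The coordinates on `ℂ^a`, as a real linear equivalence. -/
noncomputable def complexCoords : EuclideanSpace ℂ (Fin a) ≃ₗ[ℝ] (Fin a → ℂ) :=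
  (WithLp.linearEquiv 2 ℂ (Fin a → ℂ)).restrictScalars ℝ

/-- The coordinates on `ℝ^b`. -/
noncomputable def realCoords : EuclideanSpace ℝ (Fin b) ≃ₗ[ℝ] (Fin b → ℝ) :=
  WithLp.linearEquiv 2 ℝ (Fin b → ℝ)

variable {a b}

lemma complexCoords_turn (v : EuclideanSpace ℂ (Fin a)) :
    complexCoords a (turn v) = turn (complexCoords a v) := rfl

lemma realCoords_turn (x : EuclideanSpace ℝ (Fin b)) :
    realCoords b (turn x) = turn (realCoords b x) := rfl

lemma complexCoords_symm_turn (v : Fin a → ℂ) :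
    (complexCoords a).symm (turn v) = turn ((complexCoords a).symm v) := rfl

lemma realCoords_symm_turn (x : Fin b → ℝ) :
    (realCoords b).symm (turn x) = turn ((realCoords b).symm x) := rfl

end Coordinates

end Desuspension

open Desuspension QuarterTurn

/-- **Equivariant desuspension.**  Given `n₁ ≤ n₀`, `m₁ - m₀ ≥ 2`,
`n₀ - n₁ ≤ m₁ - m₀ - 1`, and a continuous pointed `ℤ/4`-map
`f : (ℂ₊^{n₀} ⊕ ℝ̃^{m₀})⁺ → (ℂ₊^{n₁} ⊕ ℝ̃^{m₁})⁺` with `f ∞ = ∞` and `f 0 = 0`,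
there exists a continuous pointed `ℤ/4`-map
`g : (ℂ₊^{n₀-n₁})⁺ → (ℝ̃^{m₁-m₀})⁺` with `g ∞ = ∞` and `g 0 = 0`. -/
theorem equivariant_desuspension (n₀ n₁ m₀ m₁ : ℕ)
    (hn : n₁ ≤ n₀) (hm : 2 ≤ (m₁ : ℤ) - (m₀ : ℤ))
    (hnm : (n₀ : ℤ) - (n₁ : ℤ) ≤ (m₁ : ℤ) - (m₀ : ℤ) - 1)
    (f : OnePoint (EuclideanSpace ℂ (Fin n₀) × EuclideanSpace ℝ (Fin m₀)) →
      OnePoint (EuclideanSpace ℂ (Fin n₁) × EuclideanSpace ℝ (Fin m₁)))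
    (hf : Continuous f)
    (hinf : f OnePoint.infty = OnePoint.infty)
    (h0 : f (OnePoint.some 0) = OnePoint.some 0)
    (heq : f ∘ sigmaMap n₀ m₀ = sigmaMap n₁ m₁ ∘ f) :
    ∃ g : OnePoint (EuclideanSpace ℂ (Fin (n₀ - n₁))) →
        OnePoint (EuclideanSpace ℝ (Fin (m₁ - m₀))),
      Continuous g ∧ g OnePoint.infty = OnePoint.infty ∧
        g (OnePoint.some 0) = OnePoint.some 0 ∧
        g ∘ rhoMap (n₀ - n₁) = tauMap (m₁ - m₀) ∘ g := by
  have hφ := isSeparating_toHomogeneous_comp hf hinf h0 fun x => congrFun heq (OnePoint.some x)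
  obtain ⟨ψ, hψ⟩ := desuspend_reals (k := m₁ - m₀) (by omega) (by omega) m₀ (by omega)
    (hφ.comp_linear ((complexCoords n₀).symm.prodCongr (realCoords m₀).symm).toLinearMap
      (LinearEquiv.injective _)
      (fun x => Prod.ext (complexCoords_symm_turn x.1) (realCoords_symm_turn x.2))
      ((complexCoords n₁).prodCongr (realCoords m₁)).toLinearMap (LinearEquiv.injective _)
      fun y => Prod.ext (complexCoords_turn y.1) (realCoords_turn y.2))
  obtain ⟨χ, hχ⟩ := desuspend_complexes (by omega) (n₀ - n₁) (by omega) (by omega) hψ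
  obtain ⟨g, hg, hginf, hg0, hgturn⟩ := (hχ.comp_linear (complexCoords (n₀ - n₁)).toLinearMap
    (LinearEquiv.injective _) complexCoords_turn (realCoords (m₁ - m₀)).symm.toLinearMap
    (LinearEquiv.injective _) realCoords_symm_turn).exists_onePoint_map
      fun v hv => eq_zero_of_turn_eq_self hv
  refine ⟨g, hg, hginf, hg0, funext fun x => ?_⟩
  induction x using OnePoint.rec with
  | infty =>
    change g OnePoint.infty = tauMap _ (g OnePoint.infty)
    rw [hginf]
    rfl
  | coe x => exact hgturn x
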